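/- arXiv:math/0611387 — 4 statements merged into one kernel-verified Lean document; each statement's English description precedes it below -/
import Mathlib

section
/- Let d ≥ 2. Let V = {α : Fin(2d-1) → ℝ : Σ_{i=0}^{2d-2} α(i) = 0}, a (2d-2)-dimensional linear subspace of ℝ^{2d-1}. There is no continuous map f from S^{d-1} × S^{d-1} (the product of the unit sphere of ℝ^d with itself) to V ∖ {0} satisfying, for all (u,v) ∈ S^{d-1} × S^{d-1}: (i) f(-u, v)(i) = f(u, v)(2d-2-i) for every index i (reversal of coordinates), and (ii) f(u, -v) = -f(u, v). -/
namespace NoEquiv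

abbrev Co (X : Type*) := List X → ZMod 2

theorem z2 (a : ZMod 2) : a + a = 0 := CharTwo.add_self_eq_zero a

section alg
variable {X : Type*}

/-- the coboundary, evaluated on a list -/
def dl : List X → Co X → ZMod 2
  | [], _ => 0
  | x :: σ, φ => φ σ + dl σ (fun τ => φ (x :: τ))

/-- the prism operator, evaluated on a list -/
def pr (h h' : X → X) : List X → Co X → ZMod 2
  | [], _ => 0
  | x :: σ, φ => φ (h x :: h' x :: σ.map h') + pr h h' σ (fun τ => φ (h x :: τ))

theorem dl_add (σ : List X) : ∀ φ ψ : Co X, dl σ (φ + ψ) = dl σ φ + dl σ ψ := by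
  induction σ with
  | nil => intro φ ψ; simp [dl]
  | cons x σ ih =>
    intro φ ψ
    have := ih (fun τ => φ (x :: τ)) (fun τ => ψ (x :: τ))
    simp only [dl, Pi.add_apply]
    rw [show (fun τ => φ (x :: τ) + ψ (x :: τ)) = (fun τ => φ (x :: τ)) + (fun τ => ψ (x :: τ)) from rfl, this]
    ring

theorem dl_smul (σ : List X) : ∀ (a : ZMod 2) (φ : Co X), dl σ (a • φ) = a * dl σ φ := by
  induction σ with
  | nil => intro φ ψ; simp [dl]
  | cons x σ ih =>
    intro a φ
    have := ih a (fun τ => φ (x :: τ))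
    simp only [dl, Pi.smul_apply, smul_eq_mul]
    rw [show (fun τ => a * φ (x :: τ)) = a • (fun τ => φ (x :: τ)) from rfl, this]
    ring

theorem pr_add (h h' : X → X) (σ : List X) : ∀ φ ψ : Co X,
    pr h h' σ (φ + ψ) = pr h h' σ φ + pr h h' σ ψ := by
  induction σ with
  | nil => intro φ ψ; simp [pr]
  | cons x σ ih =>
    intro φ ψ
    have := ih (fun τ => φ (h x :: τ)) (fun τ => ψ (h x :: τ))
    simp only [pr, Pi.add_apply]
    rw [show (fun τ => φ (h x :: τ) + ψ (h x :: τ)) =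
      (fun τ => φ (h x :: τ)) + (fun τ => ψ (h x :: τ)) from rfl, this]
    ring

theorem pr_smul (h h' : X → X) (σ : List X) : ∀ (a : ZMod 2) (φ : Co X),
    pr h h' σ (a • φ) = a * pr h h' σ φ := by
  induction σ with
  | nil => intro φ ψ; simp [pr]
  | cons x σ ih =>
    intro a φ
    have := ih a (fun τ => φ (h x :: τ))
    simp only [pr, Pi.smul_apply, smul_eq_mul]
    rw [show (fun τ => a * φ (h x :: τ)) = a • (fun τ => φ (h x :: τ)) from rfl, this]
    ring

theorem dl_map (f : X → X) (σ : List X) : ∀ φ : Co X,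
    dl (σ.map f) φ = dl σ (fun τ => φ (τ.map f)) := by
  induction σ with
  | nil => intro φ; simp [dl]
  | cons x σ ih =>
    intro φ
    simp only [dl, List.map_cons]
    rw [ih]

theorem dl_dl (σ : List X) : ∀ φ : Co X, dl σ (fun τ => dl τ φ) = 0 := by
  induction σ with
  | nil => intro φ; simp [dl]
  | cons x σ ih =>
    intro φ
    simp only [dl]
    rw [show (fun τ => φ τ + dl τ (fun τ => φ (x :: τ))) =
      φ + (fun τ => dl τ (fun τ => φ (x :: τ))) from rfl, dl_add, ih, add_zero, z2]

theorem prism (h h' : X → X) (σ : List X) : ∀ φ : Co X,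
    pr h h' σ (fun τ => dl τ φ) + dl σ (fun τ => pr h h' τ φ)
      = φ (σ.map h') + φ (σ.map h) := by
  induction σ with
  | nil => intro φ; simp [dl, pr, z2]
  | cons x σ ih =>
    intro φ
    have h1 := ih (fun τ => φ (h x :: τ))
    simp only [pr, dl, List.map_cons]
    rw [show (fun τ => φ τ + dl τ (fun τ => φ (h x :: τ))) =
      φ + (fun τ => dl τ (fun τ => φ (h x :: τ))) from rfl, pr_add]
    rw [show (fun τ => φ (h x :: h' x :: List.map h' τ) + pr h h' τ fun τ => φ (h x :: τ)) =
      (fun τ => φ (h x :: h' x :: List.map h' τ)) + (fun τ => pr h h' τ fun τ => φ (h x :: τ))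
      from rfl, dl_add, dl_map]
    have e1 := z2 (pr h h' σ φ)
    have e2 := z2 (dl σ (fun τ => φ (h x :: h' x :: List.map h' τ)))
    have e3 := z2 (φ (h x :: List.map h' σ))
    linear_combination h1 + e1 + e2 + e3

theorem pr_comm (h h' A : X → X) (hA : ∀ x, h (A x) = A (h x)) (hA' : ∀ x, h' (A x) = A (h' x))
    (σ : List X) : ∀ φ : Co X,
    pr h h' (σ.map A) φ = pr h h' σ (fun τ => φ (τ.map A)) := by
  induction σ with
  | nil => intro φ; simp [pr]
  | cons x σ ih =>
    intro φ
    simp only [pr, List.map_cons]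
    have : List.map h' (List.map A σ) = List.map A (List.map h' σ) := by simp [hA']
    rw [ih, hA, hA', this]

theorem pr_vanish (h h' : X → X) (σ : List X) : ∀ φ : Co X,
    (∀ τ : List X, (∀ y ∈ τ, ∃ x ∈ σ, y = h x ∨ y = h' x) → φ τ = 0) → pr h h' σ φ = 0 := by
  induction σ with
  | nil => intro φ _; simp [pr]
  | cons x σ ih =>
    intro φ hφ
    simp only [pr]
    rw [hφ, ih, add_zero]
    · intro τ hτ
      apply hφ
      intro y hy
      rcases List.mem_cons.1 hy with rfl | hy
      · exact ⟨x, by simp, Or.inl rfl⟩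
      · obtain ⟨z, hz, hz'⟩ := hτ y hy
        exact ⟨z, by simp [hz], hz'⟩
    · intro y hy
      rcases List.mem_cons.1 hy with rfl | hy
      · exact ⟨x, by simp, Or.inl rfl⟩
      rcases List.mem_cons.1 hy with rfl | hy
      · exact ⟨x, by simp, Or.inr rfl⟩
      · obtain ⟨z, hz, rfl⟩ := List.mem_map.1 hy
        exact ⟨z, by simp [hz], Or.inr rfl⟩

/-- coboundary as a linear map -/
def dL : Co X →ₗ[ZMod 2] Co X where
  toFun φ := fun σ => dl σ φ
  map_add' φ ψ := by ext σ; exact dl_add σ φ ψ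
  map_smul' a φ := by ext σ; exact dl_smul σ a φ

/-- prism as a linear map -/
def pL (h h' : X → X) : Co X →ₗ[ZMod 2] Co X where
  toFun φ := fun σ => pr h h' σ φ
  map_add' φ ψ := by ext σ; exact pr_add h h' σ φ ψ
  map_smul' a φ := by ext σ; exact pr_smul h h' σ a φ

/-- pullback -/
def mL (f : X → X) : Co X →ₗ[ZMod 2] Co X where
  toFun φ := fun σ => φ (σ.map f)
  map_add' _ _ := rfl
  map_smul' _ _ := rfl

/-- iterated prism -/
def DL (h : ℕ → X → X) (M : ℕ) : Co X →ₗ[ZMod 2] Co X :=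
  ∑ t ∈ Finset.range M, pL (h t) (h (t+1))

theorem co_self (φ : Co X) : φ + φ = 0 := by ext σ; exact z2 _

theorem DL_homotopy (h : ℕ → X → X) (M : ℕ) (φ : Co X) :
    DL h M (dL φ) = dL (DL h M φ) + mL (h M) φ + mL (h 0) φ := by
  induction M with
  | zero => simp [DL, co_self]
  | succ M ih =>
    have e : DL h (M+1) = DL h M + pL (h M) (h (M+1)) := by
      simp [DL, Finset.sum_range_succ]
    rw [e, LinearMap.add_apply, ih, LinearMap.add_apply, map_add]
    have : pL (h M) (h (M+1)) (dL φ) + dL (pL (h M) (h (M+1)) φ) =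
      mL (h (M+1)) φ + mL (h M) φ := by
      ext σ; exact prism _ _ σ φ
    have e1 := co_self (mL (h M) φ)
    have e2 := co_self (dL (pL (h M) (h (M+1)) φ))
    linear_combination (exp := 1) this + e1 - e2

theorem DL_nil (h : ℕ → X → X) (M : ℕ) (φ : Co X) : DL h M φ [] = 0 := by
  simp [DL, pL, pr]

theorem DL_comm (h : ℕ → X → X) (M : ℕ) (A : X → X) (hA : ∀ t x, h t (A x) = A (h t x))
    (φ : Co X) : mL A (DL h M φ) = DL h M (mL A φ) := by
  simp only [DL, LinearMap.sum_apply, map_sum]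
  refine Finset.sum_congr rfl fun t _ => ?_
  ext σ
  exact pr_comm _ _ A (hA t) (hA (t+1)) σ φ

/-- step operator -/
def TL (h : ℕ → X → X) (M : ℕ) (B : X → X) : Co X →ₗ[ZMod 2] Co X :=
  DL h M + mL B ∘ₗ DL h M

theorem TL_apply (h : ℕ → X → X) (M : ℕ) (B : X → X) (φ : Co X) :
    TL h M B φ = DL h M φ + mL B (DL h M φ) := rfl

/-- the boundary relation -/
def Inv (c : Co X →ₗ[ZMod 2] ZMod 2) (B : X → X) (c' : Co X →ₗ[ZMod 2] ZMod 2)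
    (A : X → X) (z : Co X →ₗ[ZMod 2] ZMod 2) : Prop :=
  ∀ φ : Co X, φ [] = 0 → c (dL φ) = c' (φ + mL B φ) + z (φ + mL A φ)

theorem mL_mL (f g : X → X) (φ : Co X) : mL f (mL g φ) = mL (g ∘ f) φ := by
  ext σ; simp [mL]

theorem mL_id (φ : Co X) : mL id φ = φ := by
  ext σ; simp [mL]

theorem Inv.step {c c' z : Co X →ₗ[ZMod 2] ZMod 2} {A B : X → X} (hI : Inv c B c' A z)
    (h : ℕ → X → X) (M : ℕ) (h0 : h 0 = id) (hM : ∀ x, h M (B x) = h M x)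
    (hB : ∀ x, B (B x) = x) (hAB : ∀ x, A (B x) = B (A x))
    (hA : ∀ t x, h t (A x) = A (h t x)) :
    Inv (c ∘ₗ TL h M B) B c A (z ∘ₗ TL h M B) := by
  intro φ hφ
  have e1 : TL h M B (dL φ) = dL (TL h M B φ) + (φ + mL B φ) := by
    rw [TL_apply, TL_apply, DL_homotopy, h0, mL_id, map_add, map_add, map_add, mL_mL]
    have : h M ∘ B = h M := funext hM
    rw [this]
    have : mL B (dL (DL h M φ)) = dL (mL B (DL h M φ)) := by
      ext σ; exact dl_map B σ _
    rw [this]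
    linear_combination (exp := 1) co_self (mL (h M) φ)
  have e2 : (TL h M B φ) [] = 0 := by
    simp [TL_apply, mL, DL_nil]
  have e3 : TL h M B φ + mL B (TL h M B φ) = 0 := by
    rw [TL_apply, map_add, mL_mL, show B ∘ B = id from funext hB, mL_id]
    linear_combination (exp := 1) co_self (DL h M φ) + co_self (mL B (DL h M φ))
  have e4 : mL A (TL h M B φ) = TL h M B (mL A φ) := by
    rw [TL_apply, TL_apply, map_add, mL_mL, ← DL_comm h M A hA, mL_mL,
      show B ∘ A = A ∘ B from funext fun x => (hAB x).symm]
  simp only [LinearMap.comp_apply]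
  rw [e1, map_add, hI _ e2, e3, e4, map_zero, zero_add, map_add, map_add, map_add]
  rw [map_add]
  ring

/-- the cup product cochain -/
def KE : List (X → ZMod 2) → Co X
  | [], [_] => 1
  | e :: E, x :: y :: σ => (e x + e y) * KE E (y :: σ)
  | _, _ => 0

/-- primitive -/
def Lf (e : X → ZMod 2) (E : List (X → ZMod 2)) : Co X
  | [] => 0
  | x :: σ => e x * KE E (x :: σ)

theorem KE_nil (E : List (X → ZMod 2)) : KE E [] = 0 := by
  cases E <;> simp [KE]

theorem dL_Lf_aux (e : X → ZMod 2) (E : List (X → ZMod 2)) (hE : ∀ σ, dl σ (KE E) = 0) :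
    KE (e :: E) = dL (Lf e E) := by
  ext σ
  change _ = dl σ (Lf e E)
  match σ with
  | [] => simp [KE, dl]
  | [x] => simp [KE, dl, Lf]
  | x :: y :: ρ =>
    have h1 := hE (x :: y :: ρ)
    rw [dl] at h1 ⊢
    have : (fun τ => Lf e E (x :: τ)) = e x • (fun τ => KE E (x :: τ)) := rfl
    rw [this, dl_smul]
    simp only [KE, Lf]
    linear_combination (-e x) * h1 + z2 (e x * KE E (y :: ρ))

theorem dl_KE (E : List (X → ZMod 2)) : ∀ σ, dl σ (KE E) = 0 := by
  induction E with
  | nil =>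
    intro σ
    match σ with
    | [] => simp [dl]
    | [x] => simp [dl, KE]
    | [x, y] => simp [dl, KE, z2]
    | [x, y, z] => simp [dl, KE]
    | x :: y :: z :: w :: ρ =>
      simp only [dl, KE]
      have h0 : ∀ ρ : List X, dl ρ (fun _ => (0 : ZMod 2)) = 0 := by
        intro ρ; induction ρ <;> simp_all [dl]
      simp [h0]
  | cons e E ih =>
    intro σ
    rw [dL_Lf_aux e E ih]
    exact dl_dl σ _

theorem dL_Lf (e : X → ZMod 2) (E : List (X → ZMod 2)) : KE (e :: E) = dL (Lf e E) :=
  dL_Lf_aux e E (dl_KE E)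

theorem KE_const (E : List (X → ZMod 2)) : ∀ (σ : List X),
    (∃ e ∈ E, ∀ x ∈ σ, ∀ y ∈ σ, e x = e y) → KE E σ = 0 := by
  induction E with
  | nil => intro σ h; simp at h
  | cons e E ih =>
    intro σ h
    match σ with
    | [] => simp [KE]
    | [x] => simp [KE]
    | x :: y :: ρ =>
      obtain ⟨e', he', h⟩ := h
      rcases List.mem_cons.1 he' with rfl | he'
      · simp only [KE]
        rw [h x (by simp) y (by simp), z2, zero_mul]
      · simp only [KE]
        rw [ih (y :: ρ) ⟨e', he', fun a ha b hb => h a (List.mem_cons_of_mem _ ha) b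
          (List.mem_cons_of_mem _ hb)⟩, mul_zero]

theorem KE_map (B : X → X) (S : Set X) (E : List (X → ZMod 2)) : ∀ (σ : List X)
    (_ : ∀ x ∈ σ, x ∈ S) (_ : ∀ e ∈ E, ∃ a : ZMod 2, ∀ x ∈ S, e (B x) = e x + a),
    KE E (σ.map B) = KE E σ := by
  induction E with
  | nil =>
    intro σ hσ hE
    match σ with
    | [] => rfl
    | [x] => rfl
    | x :: y :: ρ => simp [KE]
  | cons e E ih =>
    intro σ hσ hE
    match σ with
    | [] => rfl
    | [x] => rfl
    | x :: y :: ρ =>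
      obtain ⟨a, ha⟩ := hE e (by simp)
      have := ih (y :: ρ) (fun x hx => hσ x (List.mem_cons_of_mem _ hx))
        (fun e he => hE e (List.mem_cons_of_mem _ he))
      simp only [List.map_cons] at this
      simp only [List.map_cons, KE, this, ha x (hσ x (by simp)), ha y (hσ y (by simp))]
      linear_combination z2 a * KE E (y :: ρ)

end alg

section met
variable {X : Type*} [PseudoMetricSpace X]

/-- small lists -/
def Good (S : Set X) (r : ℝ) (σ : List X) : Prop :=
  (∀ x ∈ σ, x ∈ S) ∧ ∀ x ∈ σ, ∀ y ∈ σ, dist x y ≤ r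

/-- support condition -/
def Supp (c : Co X →ₗ[ZMod 2] ZMod 2) (S : Set X) (r : ℝ) : Prop :=
  ∀ φ : Co X, (∀ σ, Good S r σ → φ σ = 0) → c φ = 0

theorem Supp.mono {c : Co X →ₗ[ZMod 2] ZMod 2} {S S' : Set X} {r r' : ℝ} (h : Supp c S r)
    (hS : S ⊆ S') (hr : r ≤ r') : Supp c S' r' := by
  intro φ hφ
  exact h φ fun σ hσ => hφ σ ⟨fun x hx => hS (hσ.1 x hx),
    fun x hx y hy => (hσ.2 x hx y hy).trans hr⟩

theorem Supp.congr {c : Co X →ₗ[ZMod 2] ZMod 2} {S : Set X} {r : ℝ} (h : Supp c S r)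
    {φ ψ : Co X} (hh : ∀ σ, Good S r σ → φ σ = ψ σ) : c φ = c ψ := by
  rw [← sub_eq_zero, ← map_sub]
  exact h _ fun σ hσ => by simp [hh σ hσ]

theorem Supp.step {c : Co X →ₗ[ZMod 2] ZMod 2} {S S' : Set X} {r ρ : ℝ} (hc : Supp c S r)
    (h : ℕ → X → X) (M : ℕ) (B : X → X)
    (hB : ∀ x ∈ S, B x ∈ S) (hBd : ∀ x y, dist (B x) (B y) ≤ dist x y)
    (hS : ∀ t ≤ M, ∀ x ∈ S, h t x ∈ S')
    (hd : ∀ t ≤ M, ∀ t' ≤ M, t' ≤ t + 1 → t ≤ t' + 1 → ∀ x ∈ S, ∀ y ∈ S,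
      dist (h t x) (h t' y) ≤ dist x y + ρ) :
    Supp (c ∘ₗ TL h M B) S' (r + ρ) := by
  intro φ hφ
  have key : ∀ σ, Good S r σ → DL h M φ σ = 0 := by
    intro σ hσ
    simp only [DL, LinearMap.sum_apply, Finset.sum_apply]
    refine Finset.sum_eq_zero fun t ht => ?_
    rw [Finset.mem_range] at ht
    refine pr_vanish _ _ σ φ fun τ hτ => hφ τ ⟨?_, ?_⟩
    · intro y hy
      obtain ⟨x, hx, rfl | rfl⟩ := hτ y hy
      · exact hS _ (by omega) x (hσ.1 x hx)
      · exact hS _ (by omega) x (hσ.1 x hx)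
    · intro y hy y' hy'
      obtain ⟨x, hx, h1⟩ := hτ y hy
      obtain ⟨x', hx', h2⟩ := hτ y' hy'
      have := hσ.2 x hx x' hx'
      rcases h1 with rfl | rfl <;> rcases h2 with rfl | rfl <;>
      · refine (hd _ (by omega) _ (by omega) (by omega) (by omega) x (hσ.1 x hx) x' (hσ.1 x' hx')).trans ?_
        linarith
  refine hc _ fun σ hσ => ?_
  rw [TL_apply, Pi.add_apply, key σ hσ]
  change 0 + DL h M φ (σ.map B) = 0
  rw [key, add_zero]
  refine ⟨?_, ?_⟩
  · intro y hy
    obtain ⟨x, hx, rfl⟩ := List.mem_map.1 hy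
    exact hB x (hσ.1 x hx)
  · intro y hy y' hy'
    obtain ⟨x, hx, rfl⟩ := List.mem_map.1 hy
    obtain ⟨x', hx', rfl⟩ := List.mem_map.1 hy'
    exact (hBd _ _).trans (hσ.2 x hx x' hx')

/-- evaluation step -/
theorem eval_step {c c' z : Co X →ₗ[ZMod 2] ZMod 2} {A B : X → X} (hI : Inv c B c' A z)
    {S : Set X} {r : ℝ} (hc : Supp c' S r) (hz : Supp z S r)
    (e : X → ZMod 2) (E : List (X → ZMod 2))
    (heB : ∀ x ∈ S, e (B x) = e x + 1) (heA : ∀ x ∈ S, e (A x) = e x)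
    (hEB : ∀ e ∈ E, ∃ a : ZMod 2, ∀ x ∈ S, e (B x) = e x + a)
    (hEA : ∀ e ∈ E, ∃ a : ZMod 2, ∀ x ∈ S, e (A x) = e x + a) :
    c (KE (e :: E)) = c' (KE E) := by
  rw [dL_Lf, hI _ rfl]
  have h1 : c' (Lf e E + mL B (Lf e E)) = c' (KE E) := by
    refine hc.congr fun σ hσ => ?_
    have h := KE_map B S E σ hσ.1 hEB
    match σ with
    | [] => simp [mL, Lf, KE_nil]
    | x :: σ =>
      change e x * KE E (x :: σ) + e (B x) * KE E ((x :: σ).map B) = _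
      rw [h, heB x (hσ.1 x (by simp))]
      linear_combination z2 (e x) * KE E (x :: σ)
  have h2 : z (Lf e E + mL A (Lf e E)) = 0 := by
    refine hz _ fun σ hσ => ?_
    have h := KE_map A S E σ hσ.1 hEA
    match σ with
    | [] => simp [mL, Lf]
    | x :: σ =>
      change e x * KE E (x :: σ) + e (A x) * KE E ((x :: σ).map A) = _
      rw [h, heA x (hσ.1 x (by simp))]
      exact z2 _
  rw [h1, h2, add_zero]

end met

section geo
variable {n : ℕ}

/-- ℓ¹-unit vectors in the span of the first `k+1` coordinates -/
def Q (n k : ℕ) : Set (Fin (n+1) → ℝ) :=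
  {u | ∑ i, |u i| = 1 ∧ ∀ i : Fin (n+1), k < i.val → u i = 0}

/-- straight-line homotopy -/
def hom (j : Fin (n+1)) (s : ℝ) (u : Fin (n+1) → ℝ) : Fin (n+1) → ℝ :=
  (1 - s) • u + s • Pi.single j 1

theorem Q_mono {k l : ℕ} (h : k ≤ l) : Q n k ⊆ Q n l :=
  fun _ hu => ⟨hu.1, fun i hi => hu.2 i (by omega)⟩

theorem Q_neg {k : ℕ} {u : Fin (n+1) → ℝ} (h : u ∈ Q n k) : -u ∈ Q n k :=
  ⟨by simpa using h.1, fun i hi => by simp [h.2 i hi]⟩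

theorem Q_norm {k : ℕ} {u : Fin (n+1) → ℝ} (h : u ∈ Q n k) : ‖u‖ ≤ 1 := by
  rw [pi_norm_le_iff_of_nonneg zero_le_one]
  intro i
  rw [← h.1, Real.norm_eq_abs]
  exact Finset.single_le_sum (f := fun i => |u i|) (fun i _ => abs_nonneg _) (Finset.mem_univ i)

theorem Q_ne {k : ℕ} {u : Fin (n+1) → ℝ} (h : u ∈ Q n k) : u ≠ 0 := by
  rintro rfl
  have := h.1
  simp at this

theorem Q_zero : (Pi.single 0 1 : Fin (n+1) → ℝ) ∈ Q n 0 := by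
  refine ⟨?_, ?_⟩
  · rw [Finset.sum_eq_single 0]
    · simp
    · intro b _ hb; simp [hb]
    · simp
  · intro i hi
    have : i ≠ 0 := by rintro rfl; simp at hi
    simp [this]

theorem hom_Q {k : ℕ} {u : Fin (n+1) → ℝ} (h : u ∈ Q n k) (j : Fin (n+1)) (hj : j.val = k + 1)
    {s : ℝ} (h0 : 0 ≤ s) (h1 : s ≤ 1) : hom j s u ∈ Q n (k+1) := by
  refine ⟨?_, ?_⟩
  · have : ∀ i, |hom j s u i| = (1 - s) * |u i| + s * (Pi.single j 1 : Fin (n+1) → ℝ) i := by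
      intro i
      by_cases hi : i = j
      · subst hi
        have : u i = 0 := h.2 i (by omega)
        simp [hom, this, abs_of_nonneg h0]
      · simp [hom, hi, abs_mul, abs_of_nonneg (sub_nonneg.2 h1)]
    simp only [this]
    rw [Finset.sum_add_distrib, ← Finset.mul_sum, ← Finset.mul_sum, h.1]
    simp
  · intro i hi
    have : i ≠ j := by rintro rfl; omega
    simp [hom, this, h.2 i (by omega)]

theorem hom_dist {k : ℕ} {u v : Fin (n+1) → ℝ} (hv : v ∈ Q n k)
    (j : Fin (n+1)) {s s' : ℝ} (h0 : 0 ≤ s) (h1 : s ≤ 1) :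
    dist (hom j s u) (hom j s' v) ≤ dist u v + 2 * |s - s'| := by
  rw [dist_eq_norm, dist_eq_norm]
  have e : hom j s u - hom j s' v = (1 - s) • (u - v) + (s - s') • (Pi.single j 1 - v) := by
    simp only [hom]; module
  rw [e]
  have h2 : ‖(Pi.single j 1 - v : Fin (n+1) → ℝ)‖ ≤ 2 := by
    refine (norm_sub_le _ _).trans ?_
    have : ‖(Pi.single j 1 : Fin (n+1) → ℝ)‖ ≤ 1 := by
      rw [pi_norm_le_iff_of_nonneg zero_le_one]
      intro i
      by_cases hi : i = j
      · subst hi; simp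
      · simp [hi]
    have := Q_norm hv
    linarith
  refine (norm_add_le _ _).trans ?_
  rw [norm_smul, norm_smul, Real.norm_eq_abs, Real.norm_eq_abs, abs_of_nonneg (sub_nonneg.2 h1)]
  have h3 := norm_nonneg (u - v)
  have h4 := abs_nonneg (s - s')
  nlinarith

theorem step_abs {M t t' : ℕ} (h1 : t' ≤ t + 1) (h2 : t ≤ t' + 1) :
    |(t : ℝ) / M - t' / M| ≤ 1 / M := by
  rw [← sub_div, abs_div, abs_of_nonneg (Nat.cast_nonneg M : (0:ℝ) ≤ M)]
  gcongr
  rw [abs_le]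
  have h1 : (t' : ℝ) ≤ t + 1 := by exact_mod_cast h1
  have h2 : (t : ℝ) ≤ t' + 1 := by exact_mod_cast h2
  constructor <;> linarith

abbrev XX (n : ℕ) := (Fin (n+1) → ℝ) × (Fin (n+1) → ℝ)

/-- antipode on the first factor -/
def Am (x : XX n) : XX n := (-x.1, x.2)
/-- antipode on the second factor -/
def Bm (x : XX n) : XX n := (x.1, -x.2)

/-- homotopy in the first factor -/
noncomputable def hu (j : Fin (n+1)) (M t : ℕ) (x : XX n) : XX n := (hom j ((t : ℝ) / M) x.1, x.2)
/-- homotopy in the second factor -/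
noncomputable def hv (j : Fin (n+1)) (M t : ℕ) (x : XX n) : XX n := (x.1, hom j ((t : ℝ) / M) x.2)

theorem frac {M t : ℕ} (hM : 0 < M) (ht : t ≤ M) : 0 ≤ (t : ℝ) / M ∧ (t : ℝ) / M ≤ 1 := by
  refine ⟨by positivity, ?_⟩
  rw [div_le_one (by exact_mod_cast hM)]
  exact_mod_cast ht

theorem hu_dist {k l M t t' : ℕ} (hM : 0 < M) (j : Fin (n+1)) (ht : t ≤ M)
    (h1 : t' ≤ t + 1) (h2 : t ≤ t' + 1) (x y : XX n) (hy : y ∈ Q n k ×ˢ Q n l) :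
    dist (hu j M t x) (hu j M t' y) ≤ dist x y + 2 * (1 / M) := by
  have hb := step_abs (M := M) h1 h2
  have hf := frac hM ht
  have h3 := hom_dist (u := x.1) hy.1 j (s' := (t' : ℝ) / M) hf.1 hf.2
  have h4 : dist x.1 y.1 ≤ dist x y := by rw [Prod.dist_eq]; exact le_max_left _ _
  have h5 : dist x.2 y.2 ≤ dist x y := by rw [Prod.dist_eq]; exact le_max_right _ _
  rw [Prod.dist_eq (x := hu j M t x)]
  refine max_le ?_ ?_
  · simp only [hu]; linarith
  · have : (0 : ℝ) ≤ 1 / M := by positivity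
    simp only [hu]; linarith

theorem hv_dist {k l M t t' : ℕ} (hM : 0 < M) (j : Fin (n+1)) (ht : t ≤ M)
    (h1 : t' ≤ t + 1) (h2 : t ≤ t' + 1) (x y : XX n) (hy : y ∈ Q n k ×ˢ Q n l) :
    dist (hv j M t x) (hv j M t' y) ≤ dist x y + 2 * (1 / M) := by
  have hb := step_abs (M := M) h1 h2
  have hf := frac hM ht
  have h3 := hom_dist (u := x.2) hy.2 j (s' := (t' : ℝ) / M) hf.1 hf.2
  have h4 : dist x.1 y.1 ≤ dist x y := by rw [Prod.dist_eq]; exact le_max_left _ _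
  have h5 : dist x.2 y.2 ≤ dist x y := by rw [Prod.dist_eq]; exact le_max_right _ _
  rw [Prod.dist_eq (x := hv j M t x)]
  refine max_le ?_ ?_
  · have : (0 : ℝ) ≤ 1 / M := by positivity
    simp only [hv]; linarith
  · simp only [hv]; linarith

theorem Am_dist (x y : XX n) : dist (Am x) (Am y) ≤ dist x y := by
  simp [Am, Prod.dist_eq, dist_neg_neg]

theorem Bm_dist (x y : XX n) : dist (Bm x) (Bm y) ≤ dist x y := by
  simp [Bm, Prod.dist_eq, dist_neg_neg]

/-- evaluation functional -/
def ev (x : XX n) : Co (XX n) →ₗ[ZMod 2] ZMod 2 := LinearMap.proj [x]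

theorem phase1 (M : ℕ) (hM : 0 < M) (k : ℕ) (hk : k ≤ n) :
    ∃ c c' : Co (XX n) →ₗ[ZMod 2] ZMod 2, Inv c Am c' id 0 ∧
      Supp c (Q n k ×ˢ Q n 0) (k * (2 * (1 / M))) ∧
      Supp c' (Q n k ×ˢ Q n 0) (k * (2 * (1 / M))) ∧
      ∀ E : List (XX n → ZMod 2), E.length = k →
        (∀ e ∈ E, ∀ x ∈ Q n n ×ˢ Q n n, e (Am x) = e x + 1) → c (KE E) = 1 := by
  induction k with
  | zero =>
    refine ⟨ev (Pi.single 0 1, Pi.single 0 1), 0, ?_, ?_, ?_, ?_⟩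
    · intro φ hφ
      simp [ev, dL, dl, hφ]
    · intro φ hφ
      refine hφ _ ⟨?_, ?_⟩
      · intro x hx
        simp only [List.mem_singleton] at hx
        subst hx
        exact ⟨Q_zero, Q_zero⟩
      · intro x hx y hy
        simp only [List.mem_singleton] at hx hy
        subst hx hy
        simp
    · intro φ hφ; rfl
    · intro E hE _
      rw [List.length_eq_zero_iff] at hE
      subst hE
      simp [ev, KE]
  | succ k ih =>
    obtain ⟨c, c', hI, hc, hc', hE⟩ := ih (by omega)
    have hρ : (0 : ℝ) ≤ 2 * (1 / M) := by positivity
    set ρ : ℝ := 2 * (1 / M) with hρd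
    let j : Fin (n+1) := ⟨k+1, by omega⟩
    have hMr : (M : ℝ) ≠ 0 := by positivity
    have hI' := hI.step (hu j M) M (by ext x : 1; simp [hu, hom])
      (by intro x; simp [hu, hom, Am, hMr]) (by intro x; simp [Am])
      (by intro x; rfl) (by intro t x; rfl)
    rw [LinearMap.zero_comp] at hI'
    have hr : ((k + 1 : ℕ) : ℝ) * ρ = k * ρ + ρ := by push_cast; ring
    refine ⟨_, _, hI', ?_, ?_, ?_⟩
    · rw [hr]
      refine hc.step (hu j M) M Am ?_ Am_dist ?_ ?_
      · intro x hx; exact ⟨Q_neg hx.1, hx.2⟩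
      · intro t ht x hx
        have hf := frac hM ht
        exact ⟨hom_Q hx.1 j rfl hf.1 hf.2, hx.2⟩
      · intro t ht t' ht' h1 h2 x hx y hy
        exact hu_dist hM j ht h1 h2 x y hy
    · refine hc.mono (Set.prod_mono (Q_mono (by omega)) subset_rfl) ?_
      rw [hr]; linarith
    · intro E hEl hEA
      obtain ⟨e, E, rfl⟩ := List.exists_cons_of_length_eq_add_one hEl
      have hsub : Q n k ×ˢ Q n 0 ⊆ Q n n ×ˢ Q n n :=
        Set.prod_mono (Q_mono (by omega)) (Q_mono (by omega))
      rw [eval_step hI' hc (fun φ _ => rfl) e E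
        (fun x hx => hEA e (by simp) x (hsub hx)) (fun x _ => rfl)
        (fun e he => ⟨1, fun x hx => hEA e (by simp [he]) x (hsub hx)⟩)
        (fun e he => ⟨0, fun x hx => by simp⟩)]
      exact hE E (by simpa using hEl) fun e he => hEA e (by simp [he])

theorem phase2 (M : ℕ) (hM : 0 < M) (l : ℕ) (hl : l ≤ n) :
    ∃ c c' z : Co (XX n) →ₗ[ZMod 2] ZMod 2, Inv c Bm c' Am z ∧
      Supp c (Q n n ×ˢ Q n l) ((n + l) * (2 * (1 / M))) ∧
      Supp c' (Q n n ×ˢ Q n l) ((n + l) * (2 * (1 / M))) ∧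
      Supp z (Q n n ×ˢ Q n l) ((n + l) * (2 * (1 / M))) ∧
      ∀ E1 E2 : List (XX n → ZMod 2), E1.length = l → E2.length = n →
        (∀ e ∈ E1, ∀ x ∈ Q n n ×ˢ Q n n, e (Am x) = e x ∧ e (Bm x) = e x + 1) →
        (∀ e ∈ E2, ∀ x ∈ Q n n ×ˢ Q n n, e (Am x) = e x + 1 ∧ e (Bm x) = e x + 1) →
        c (KE (E1 ++ E2)) = 1 := by
  induction l with
  | zero =>
    obtain ⟨c, c', hI, hc, hc', hE⟩ := phase1 (n := n) M hM n le_rfl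
    refine ⟨c, 0, c', ?_, by simpa using hc, fun φ _ => rfl, by simpa using hc', ?_⟩
    · intro φ hφ
      rw [hI φ hφ]
      simp
    · intro E1 E2 h1 h2 _ hE2
      rw [List.length_eq_zero_iff] at h1
      subst h1
      exact hE E2 h2 fun e he x hx => (hE2 e he x hx).1
  | succ k ih =>
    obtain ⟨c, c', z, hI, hc, hc', hz, hE⟩ := ih (by omega)
    have hρ : (0 : ℝ) ≤ 2 * (1 / M) := by positivity
    set ρ : ℝ := 2 * (1 / M) with hρd
    let j : Fin (n+1) := ⟨k+1, by omega⟩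
    have hMr : (M : ℝ) ≠ 0 := by positivity
    have hI' := hI.step (hv j M) M (by ext x : 1; simp [hv, hom])
      (by intro x; simp [hv, hom, Bm, hMr]) (by intro x; simp [Bm])
      (by intro x; rfl) (by intro t x; rfl)
    have hr : ((n : ℝ) + (k + 1 : ℕ)) * ρ = (n + k) * ρ + ρ := by push_cast; ring
    have hst : ∀ c : Co (XX n) →ₗ[ZMod 2] ZMod 2, Supp c (Q n n ×ˢ Q n k) ((n + k) * ρ) →
        Supp (c ∘ₗ TL (hv j M) M Bm) (Q n n ×ˢ Q n (k+1)) ((n + k) * ρ + ρ) := by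
      intro c hc
      refine hc.step (hv j M) M Bm ?_ Bm_dist ?_ ?_
      · intro x hx; exact ⟨hx.1, Q_neg hx.2⟩
      · intro t ht x hx
        have hf := frac hM ht
        exact ⟨hx.1, hom_Q hx.2 j rfl hf.1 hf.2⟩
      · intro t ht t' ht' h1 h2 x hx y hy
        exact hv_dist hM j ht h1 h2 x y hy
    have hcm : Supp c (Q n n ×ˢ Q n (k+1)) ((n + k) * ρ + ρ) :=
      hc.mono (Set.prod_mono subset_rfl (Q_mono (by omega))) (by linarith)
    refine ⟨_, _, _, hI', ?_, ?_, ?_, ?_⟩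
    · rw [hr]; exact hst c hc
    · rw [hr]; exact hcm
    · rw [hr]; exact hst z hz
    · intro E1 E2 hEl hE2l hE1 hE2
      obtain ⟨e, E, rfl⟩ := List.exists_cons_of_length_eq_add_one hEl
      have hsub : Q n n ×ˢ Q n (k+1) ⊆ Q n n ×ˢ Q n n :=
        Set.prod_mono subset_rfl (Q_mono (by omega))
      rw [List.cons_append, eval_step hI' hcm (hst z hz) e (E ++ E2)
        (fun x hx => (hE1 e (by simp) x (hsub hx)).2)
        (fun x hx => (hE1 e (by simp) x (hsub hx)).1)]
      · exact hE E E2 (by simpa using hEl) hE2l (fun e he => hE1 e (by simp [he])) hE2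
      · intro e he
        refine ⟨1, fun x hx => ?_⟩
        rcases List.mem_append.1 he with he | he
        · exact (hE1 e (by simp [he]) x (hsub hx)).2
        · exact (hE2 e he x (hsub hx)).2
      · intro e he
        rcases List.mem_append.1 he with he | he
        · exact ⟨0, fun x hx => by simpa using (hE1 e (by simp [he]) x (hsub hx)).1⟩
        · exact ⟨1, fun x hx => (hE2 e he x (hsub hx)).1⟩

theorem exists_small (r : ℝ) (hr : 0 < r) (E1 E2 : List (XX n → ZMod 2))
    (h1 : E1.length = n) (h2 : E2.length = n)
    (hE1 : ∀ e ∈ E1, ∀ x ∈ Q n n ×ˢ Q n n, e (Am x) = e x ∧ e (Bm x) = e x + 1)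
    (hE2 : ∀ e ∈ E2, ∀ x ∈ Q n n ×ˢ Q n n, e (Am x) = e x + 1 ∧ e (Bm x) = e x + 1) :
    ∃ σ, Good (Q n n ×ˢ Q n n) r σ ∧ KE (E1 ++ E2) σ ≠ 0 := by
  obtain ⟨M, hM⟩ := exists_nat_gt (((n : ℝ) + n) * 2 / r)
  have hMp : (0 : ℝ) < M := lt_of_le_of_lt (by positivity) hM
  have hM0 : 0 < M := by exact_mod_cast hMp
  obtain ⟨c, c', z, -, hc, -, -, hE⟩ := phase2 (n := n) M hM0 n le_rfl
  have hv := hE E1 E2 h1 h2 hE1 hE2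
  by_contra! hcon
  have : Supp c (Q n n ×ˢ Q n n) r := by
    refine hc.mono subset_rfl ?_
    rw [div_lt_iff₀ hr] at hM
    rw [mul_one_div, ← mul_div_assoc, div_le_iff₀ hMp]
    linarith
  rw [this _ hcon] at hv
  exact absurd hv (by decide)

theorem exists_b (m : ℕ) : ∃ b : (Fin m → ℝ) → ZMod 2, ∀ v, v ≠ 0 → b (-v) = b v + 1 := by
  classical
  induction m with
  | zero => exact ⟨fun _ => 0, fun v hv => absurd (Subsingleton.elim v 0) hv⟩
  | succ m ih =>
    obtain ⟨b, hb⟩ := ih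
    refine ⟨fun v => if 0 < v 0 then 1 else if v 0 < 0 then 0 else b (fun i => v i.succ),
      fun v hv => ?_⟩
    simp only [Pi.neg_apply]
    rcases lt_trichotomy (v 0) 0 with h | h | h
    · rw [if_pos (by linarith), if_neg (by linarith), if_pos h]; decide
    · rw [if_neg (by linarith), if_neg (by linarith), if_neg (by linarith), if_neg (by linarith)]
      refine hb (fun i => v i.succ) fun h' => hv ?_
      ext i
      refine Fin.cases h (fun i => congrFun h' i) i
    · rw [if_neg (by linarith), if_pos (by linarith), if_pos h]; decide

open Classical in
/-- sign cochain -/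
noncomputable def sg (φ : XX n → ℝ) (a : XX n → ZMod 2) (x : XX n) : ZMod 2 :=
  if 0 < φ x then 1 else if φ x < 0 then 0 else a x

theorem sg_even {φ : XX n → ℝ} {a : XX n → ZMod 2} {x y : XX n} (h : φ y = φ x) (ha : a y = a x) :
    sg φ a y = sg φ a x := by
  simp [sg, h, ha]

theorem sg_odd {φ : XX n → ℝ} {a : XX n → ZMod 2} {x y : XX n} (h : φ y = - φ x)
    (ha : a y = a x + 1) : sg φ a y = sg φ a x + 1 := by
  simp only [sg, h, ha]
  rcases lt_trichotomy (φ x) 0 with h | h | h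
  · rw [if_pos (by linarith), if_neg (by linarith), if_pos h]; decide
  · rw [if_neg (by linarith), if_neg (by linarith), if_neg (by linarith), if_neg (by linarith)]
  · rw [if_neg (by linarith), if_pos (by linarith), if_pos h]; decide

theorem Q_compact (k : ℕ) : IsCompact (Q n k) := by
  refine Metric.isCompact_of_isClosed_isBounded ?_ ?_
  · have : Q n k = {u | ∑ i, |u i| = 1} ∩ ⋂ i : Fin (n+1), ⋂ _ : k < i.val, {u | u i = 0} := by
      ext u; simp [Q]
    rw [this]
    refine IsClosed.inter (isClosed_eq (by fun_prop) (by fun_prop)) ?_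
    exact isClosed_iInter fun i => isClosed_iInter fun _ => isClosed_eq (by fun_prop) (by fun_prop)
  · rw [isBounded_iff_forall_norm_le]
    exact ⟨1, fun u hu => Q_norm hu⟩

theorem core (Φ : XX n → (Fin n ⊕ Fin n → ℝ)) (hΦ : ContinuousOn Φ (Q n n ×ˢ Q n n))
    (h0 : ∀ x ∈ Q n n ×ˢ Q n n, Φ x ≠ 0)
    (hA1 : ∀ x ∈ Q n n ×ˢ Q n n, ∀ i, Φ (Am x) (Sum.inl i) = Φ x (Sum.inl i))
    (hA2 : ∀ x ∈ Q n n ×ˢ Q n n, ∀ i, Φ (Am x) (Sum.inr i) = - Φ x (Sum.inr i))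
    (hB : ∀ x ∈ Q n n ×ˢ Q n n, Φ (Bm x) = - Φ x) : False := by
  have hcpt : IsCompact (Q n n ×ˢ Q n n) := (Q_compact n).prod (Q_compact n)
  have hne : (Q n n ×ˢ Q n n).Nonempty :=
    ⟨(Pi.single 0 1, Pi.single 0 1), Q_mono (by omega) Q_zero, Q_mono (by omega) Q_zero⟩
  obtain ⟨x₀, hx₀, hmin⟩ := hcpt.exists_isMinOn hne hΦ.norm
  set c := ‖Φ x₀‖ with hc
  have hcpos : 0 < c := norm_pos_iff.2 (h0 x₀ hx₀)
  have huc := hcpt.uniformContinuousOn_of_continuous hΦ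
  rw [Metric.uniformContinuousOn_iff] at huc
  obtain ⟨δ, hδ, huc⟩ := huc c hcpos
  obtain ⟨b, hb⟩ := exists_b (n+1)
  let e1 : Fin n → XX n → ZMod 2 := fun i => sg (fun x => Φ x (Sum.inl i)) (fun x => b x.2)
  let e2 : Fin n → XX n → ZMod 2 := fun i => sg (fun x => Φ x (Sum.inr i)) (fun x => b x.1 + b x.2)
  obtain ⟨σ, hσ, hK⟩ := exists_small (n := n) (δ/2) (by positivity) (List.ofFn e1) (List.ofFn e2)
    (by simp) (by simp)
    (by
      intro e he x hx
      obtain ⟨i, rfl⟩ := (List.mem_ofFn).1 he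
      exact ⟨sg_even (hA1 x hx i) rfl, sg_odd (by simp [hB x hx]) (hb _ (Q_ne hx.2))⟩)
    (by
      intro e he x hx
      obtain ⟨i, rfl⟩ := (List.mem_ofFn).1 he
      refine ⟨sg_odd (hA2 x hx i) ?_, sg_odd (by simp [hB x hx]) ?_⟩
      · change b (-x.1) + b x.2 = _
        rw [hb _ (Q_ne hx.1)]; ring
      · change b x.1 + b (-x.2) = _
        rw [hb _ (Q_ne hx.2)]; ring)
  apply hK
  apply KE_const
  have hσne : σ ≠ [] := by
    rintro rfl
    exact hK (KE_nil _)
  obtain ⟨y, hy⟩ := List.exists_mem_of_ne_nil σ hσne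
  have hyQ := hσ.1 y hy
  have hcy : c ≤ ‖Φ y‖ := hmin hyQ
  obtain ⟨i, hi⟩ : ∃ i, c ≤ |Φ y i| := by
    by_contra! hcon
    have : ‖Φ y‖ < c := (pi_norm_lt_iff hcpos).2 hcon
    linarith
  have hclose : ∀ x ∈ σ, |Φ x i - Φ y i| < c := by
    intro x hx
    have h1 := huc x (hσ.1 x hx) y hyQ (by have := hσ.2 x hx y hy; linarith)
    have h2 := dist_le_pi_dist (Φ x) (Φ y) i
    rw [Real.dist_eq] at h2
    linarith
  have hconst : ∀ a : XX n → ZMod 2, ∃ s, ∀ x ∈ σ, sg (fun x => Φ x i) a x = s := by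
    intro a
    rcases le_total 0 (Φ y i) with h | h
    · refine ⟨1, fun x hx => ?_⟩
      have h1 := abs_lt.1 (hclose x hx)
      rw [abs_of_nonneg h] at hi
      have : 0 < Φ x i := by linarith
      simp [sg, this]
    · refine ⟨0, fun x hx => ?_⟩
      have h1 := abs_lt.1 (hclose x hx)
      rw [abs_of_nonpos h] at hi
      have : Φ x i < 0 := by linarith
      simp [sg, this, this.not_gt]
  rcases i with i | i
  · refine ⟨e1 i, by simp, fun x hx x' hx' => ?_⟩
    obtain ⟨s, hs⟩ := hconst (fun x => b x.2)
    exact (hs x hx).trans (hs x' hx').symm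
  · refine ⟨e2 i, by simp, fun x hx x' hx' => ?_⟩
    obtain ⟨s, hs⟩ := hconst (fun x => b x.1 + b x.2)
    exact (hs x hx).trans (hs x' hx').symm

theorem exists_nrm (m : ℕ) : ∃ N : (Fin (m+1) → ℝ) → Metric.sphere (0 : EuclideanSpace ℝ (Fin (m+1))) 1,
    ContinuousOn N {u | u ≠ 0} ∧ ∀ u, u ≠ 0 → N (-u) = - N u := by
  classical
  have hne : ∀ u : Fin (m+1) → ℝ, u ≠ 0 → ‖WithLp.toLp 2 u‖ ≠ 0 := by
    intro u hu h
    rw [norm_eq_zero] at h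
    exact hu (by simpa using h)
  have hs : ∀ u : Fin (m+1) → ℝ, u ≠ 0 →
      ‖WithLp.toLp 2 u‖⁻¹ • (WithLp.toLp 2 u) ∈ Metric.sphere (0 : EuclideanSpace ℝ (Fin (m+1))) 1 := by
    intro u hu
    rw [mem_sphere_zero_iff_norm, norm_smul, norm_inv, norm_norm, inv_mul_cancel₀ (hne u hu)]
  have h1 : (Pi.single 0 1 : Fin (m+1) → ℝ) ≠ 0 := by simp
  refine ⟨fun u => if hu : u ≠ 0 then ⟨_, hs u hu⟩ else ⟨_, hs _ h1⟩, ?_, ?_⟩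
  · rw [Topology.IsInducing.subtypeVal.continuousOn_iff]
    have : ContinuousOn (fun u : Fin (m+1) → ℝ => ‖WithLp.toLp 2 u‖⁻¹ • (WithLp.toLp 2 u)) {u | u ≠ 0} := by
      have hc : Continuous (fun u : Fin (m+1) → ℝ => WithLp.toLp 2 u) := PiLp.continuous_toLp 2 _
      exact ContinuousOn.smul (ContinuousOn.inv₀ hc.norm.continuousOn fun u hu => hne u hu) hc.continuousOn
    refine this.congr fun u hu => ?_
    have hu : u ≠ 0 := hu
    simp [hu]
  · intro u hu
    have hu' : -u ≠ 0 := neg_ne_zero.2 hu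
    apply Subtype.ext
    simp only [dif_pos hu, dif_pos hu', WithLp.toLp_neg, norm_neg, smul_neg]
    rfl

end geo
end NoEquiv

open NoEquiv in
/-- There is no continuous `(ℤ/2 ⊕ ℤ/2)`-equivariant map from `S^{d-1} × S^{d-1}`
to `V ∖ {0}`, where `V` is the space of real functions on `{0,…,2d-2}` summing to
zero, the first generator acting antipodally on the first sphere and by reversal
of coordinates on `V`, the second generator acting antipodally on the second
sphere and by `-1` on `V`. -/
theorem no_equivariant_map_even (d : ℕ) (hd : 2 ≤ d) :
    ¬ ∃ f : (Metric.sphere (0 : EuclideanSpace ℝ (Fin d)) 1 ×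
              Metric.sphere (0 : EuclideanSpace ℝ (Fin d)) 1) → (Fin (2 * d - 1) → ℝ),
        Continuous f ∧
        (∀ p, ∑ i, f p i = 0) ∧
        (∀ p, f p ≠ 0) ∧
        (∀ u v, ∀ i : Fin (2 * d - 1),
          f (-u, v) i = f (u, v) ⟨2 * d - 2 - (i : ℕ), by omega⟩) ∧
        (∀ u v, f (u, -v) = -f (u, v)) := by
  rintro ⟨f, hf, hsum, hne, hA, hB⟩
  obtain ⟨n, rfl⟩ : ∃ n, d = n + 1 := ⟨d - 1, by omega⟩
  obtain ⟨N, hN, hNneg⟩ := exists_nrm n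
  let a : Fin n → Fin (2 * (n+1) - 1) := fun i => ⟨i.val, by omega⟩
  let a' : Fin n → Fin (2 * (n+1) - 1) := fun i => ⟨2 * (n+1) - 2 - i.val, by omega⟩
  let G : XX n → Fin (2 * (n+1) - 1) → ℝ := fun x => f (N x.1, N x.2)
  have hG : ContinuousOn G (Q n n ×ˢ Q n n) := by
    refine hf.comp_continuousOn (ContinuousOn.prodMk ?_ ?_)
    · exact hN.comp continuousOn_fst fun x hx => Q_ne hx.1
    · exact hN.comp continuousOn_snd fun x hx => Q_ne hx.2
  have hGi : ∀ i, ContinuousOn (fun x => G x i) (Q n n ×ˢ Q n n) := fun i =>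
    (continuous_apply i).comp_continuousOn hG
  have hGA : ∀ x ∈ Q n n ×ˢ Q n n, ∀ i : Fin (2 * (n+1) - 1),
      G (Am x) i = G x ⟨2 * (n+1) - 2 - (i : ℕ), by omega⟩ := by
    intro x hx i
    change f (N (-x.1), N x.2) i = _
    rw [hNneg _ (Q_ne hx.1), hA]
  have hGB : ∀ x ∈ Q n n ×ˢ Q n n, G (Bm x) = - G x := by
    intro x hx
    change f (N x.1, N (-x.2)) = _
    rw [hNneg _ (Q_ne hx.2), hB]
  have hGa : ∀ x ∈ Q n n ×ˢ Q n n, ∀ i, G (Am x) (a i) = G x (a' i) := by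
    intro x hx i
    rw [hGA x hx]
  have hGa' : ∀ x ∈ Q n n ×ˢ Q n n, ∀ i, G (Am x) (a' i) = G x (a i) := by
    intro x hx i
    rw [hGA x hx]
    congr 1
    apply Fin.ext
    simp only [a, a']
    omega
  refine core (n := n) (fun x => Sum.elim (fun i => G x (a i) + G x (a' i))
    (fun i => G x (a i) - G x (a' i))) ?_ ?_ ?_ ?_ ?_
  · refine continuousOn_pi.2 fun i => ?_
    rcases i with i | i
    · exact (hGi _).add (hGi _)
    · exact (hGi _).sub (hGi _)
  · intro x hx h
    have h1 : ∀ i, G x (a i) + G x (a' i) = 0 := fun i => congrFun h (Sum.inl i)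
    have h2 : ∀ i, G x (a i) - G x (a' i) = 0 := fun i => congrFun h (Sum.inr i)
    have hz : ∀ k : Fin (2 * (n+1) - 1), k.val ≠ n → G x k = 0 := by
      intro k hk
      rcases lt_or_gt_of_ne hk with hlt | hgt
      · have e : k = a ⟨k.val, hlt⟩ := rfl
        rw [e]
        linarith [h1 ⟨k.val, hlt⟩, h2 ⟨k.val, hlt⟩]
      · have hlt : 2 * (n+1) - 2 - k.val < n := by omega
        have e : k = a' ⟨2 * (n+1) - 2 - k.val, hlt⟩ := by
          apply Fin.ext; simp only [a']; omega
        rw [e]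
        linarith [h1 ⟨_, hlt⟩, h2 ⟨_, hlt⟩]
    have hmid : G x ⟨n, by omega⟩ = 0 := by
      have := hsum (N x.1, N x.2)
      rw [Finset.sum_eq_single (⟨n, by omega⟩ : Fin (2 * (n+1) - 1))] at this
      · exact this
      · intro k _ hk
        exact hz k fun h => hk (Fin.ext h)
      · simp
    apply hne (N x.1, N x.2)
    ext k
    by_cases hk : k.val = n
    · have e : k = ⟨n, by omega⟩ := Fin.ext hk
      rw [e]; exact hmid
    · exact hz k hk
  · intro x hx i
    simp only [Sum.elim_inl, hGa x hx, hGa' x hx]; ring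
  · intro x hx i
    simp only [Sum.elim_inr, hGa x hx, hGa' x hx]; ring
  · intro x hx
    ext i
    rcases i with i | i <;> simp [hGB x hx] <;> ring
end

section
/- Let d ≥ 1. Let V = {α : Fin(2d) → ℝ : Σ_{i=0}^{2d-1} α(i) = 0}, a (2d-1)-dimensional linear subspace of ℝ^{2d}. There is no continuous map f from S^d × S^d (the product of the unit sphere of ℝ^{d+1} with itself) to V ∖ {0} satisfying, for all (u,v) ∈ S^d × S^d: (i) f(-u, v)(i) = f(u, v)(2d-1-i) for every index i (reversal of coordinates), and (ii) f(u, -v) = -f(u, v). -/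
namespace EqMap

abbrev Co (V : Type*) := List V → ZMod 2

theorem z2 (a : ZMod 2) : a + a = 0 := CharTwo.add_self_eq_zero a

section
variable {V : Type*}

/-- coboundary -/
def dl : List V → Co V → ZMod 2
  | [], _ => 0
  | v :: l, φ => φ l + dl l (fun m => φ (v :: m))

/-- prism operator -/
def pr (h h' : V → V) : List V → Co V → ZMod 2
  | [], _ => 0
  | v :: l, φ => φ (h v :: h' v :: l.map h') + pr h h' l (fun m => φ (h v :: m))

theorem dl_add (l : List V) : ∀ φ ψ : Co V, dl l (fun m => φ m + ψ m) = dl l φ + dl l ψ := by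
  induction l with
  | nil => intro φ ψ; simp [dl]
  | cons v l ih =>
    intro φ ψ
    simp only [dl]
    rw [ih (fun m => φ (v :: m)) (fun m => ψ (v :: m))]
    ring

theorem dl_mul (l : List V) : ∀ (a : ZMod 2) (φ : Co V), dl l (fun m => a * φ m) = a * dl l φ := by
  induction l with
  | nil => intro φ ψ; simp [dl]
  | cons v l ih =>
    intro a φ
    simp only [dl]
    rw [ih a (fun m => φ (v :: m))]
    ring

theorem dl_zero (l : List V) : dl l (fun _ => 0) = 0 := by
  have := dl_mul l 0 (fun _ => 0)
  simpa using this

theorem dl_sum (l : List V) {ι : Type*} (s : Finset ι) (φ : ι → Co V) :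
    dl l (fun m => ∑ j ∈ s, φ j m) = ∑ j ∈ s, dl l (φ j) := by
  classical
  induction s using Finset.induction_on with
  | empty => simp [dl_zero]
  | insert a s ha ih => simp only [Finset.sum_insert ha]; rw [dl_add, ih]

theorem pr_add (h h' : V → V) (l : List V) : ∀ φ ψ : Co V,
    pr h h' l (fun m => φ m + ψ m) = pr h h' l φ + pr h h' l ψ := by
  induction l with
  | nil => intro φ ψ; simp [pr]
  | cons v l ih =>
    intro φ ψ
    simp only [pr]
    rw [ih (fun m => φ (h v :: m)) (fun m => ψ (h v :: m))]
    ring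

theorem dl_map (g : V → V) (l : List V) : ∀ φ : Co V,
    dl (l.map g) φ = dl l (fun m => φ (m.map g)) := by
  induction l with
  | nil => intro φ; simp [dl]
  | cons v l ih =>
    intro φ
    simp only [dl, List.map_cons]
    rw [ih]

theorem pr_map (g h h' k k' : V → V) (e : ∀ v, h (g v) = g (k v)) (e' : ∀ v, h' (g v) = g (k' v))
    (l : List V) : ∀ φ : Co V,
    pr h h' (l.map g) φ = pr k k' l (fun m => φ (m.map g)) := by
  induction l with
  | nil => intro φ; simp [pr]
  | cons v l ih =>
    intro φ
    simp only [pr, List.map_cons]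
    rw [ih]
    simp [e, e', Function.comp_def]

theorem dl_dl (l : List V) : ∀ φ : Co V, dl l (fun m => dl m φ) = 0 := by
  induction l with
  | nil => intro φ; simp [dl]
  | cons v l ih =>
    intro φ
    simp only [dl]
    rw [dl_add, ih, add_zero, z2]

theorem prism (h h' : V → V) (l : List V) : ∀ φ : Co V,
    pr h h' l (fun m => dl m φ) = dl l (fun m => pr h h' m φ) + φ (l.map h) + φ (l.map h') := by
  induction l with
  | nil => intro φ; simp [pr, dl, z2]
  | cons v l ih =>
    intro φ
    simp only [pr, dl, List.map_cons]
    rw [pr_add, dl_add, ih, dl_map]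
    linear_combination z2 (φ (h v :: List.map h' l))

theorem pr_vanish (h h' : V → V) (l : List V) : ∀ φ : Co V,
    (∀ l' : List V, 2 ≤ l'.length → (∀ x ∈ l', ∃ v ∈ l, x = h v ∨ x = h' v) → φ l' = 0) →
    pr h h' l φ = 0 := by
  induction l with
  | nil => intro φ _; simp [pr]
  | cons v l ih =>
    intro φ H
    simp only [pr]
    rw [H, ih, add_zero]
    · intro l' hl' hx
      apply H
      · simp; omega
      · intro x hx'
        rcases List.mem_cons.1 hx' with rfl | hx'
        · exact ⟨v, by simp, Or.inl rfl⟩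
        · obtain ⟨w, hw, hh⟩ := hx x hx'
          exact ⟨w, by simp [hw], hh⟩
    · simp
    · intro x hx
      simp only [List.mem_cons, List.mem_map] at hx
      rcases hx with rfl | rfl | ⟨w, hw, rfl⟩
      · exact ⟨v, by simp, Or.inl rfl⟩
      · exact ⟨v, by simp, Or.inr rfl⟩
      · exact ⟨w, by simp [hw], Or.inr rfl⟩

/-- discretised homotopy operator -/
def hp (H : ℕ → V → V) (N : ℕ) (φ : Co V) : Co V :=
  fun l => ∑ j ∈ Finset.range N, pr (H j) (H (j + 1)) l φ

theorem hp_add (H : ℕ → V → V) (N : ℕ) (φ ψ : Co V) (l : List V) :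
    hp H N (fun m => φ m + ψ m) l = hp H N φ l + hp H N ψ l := by
  simp only [hp, pr_add, Finset.sum_add_distrib]

theorem hp_map (g : V → V) (H : ℕ → V → V) (N : ℕ) (e : ∀ j v, H j (g v) = g (H j v))
    (φ : Co V) (l : List V) :
    hp H N φ (l.map g) = hp H N (fun m => φ (m.map g)) l := by
  simp only [hp]
  refine Finset.sum_congr rfl fun j _ => ?_
  exact pr_map g _ _ _ _ (e j) (e (j+1)) l φ

theorem hp_dl (H : ℕ → V → V) (N : ℕ) (φ : Co V) (l : List V) :
    hp H N (fun m => dl m φ) l = dl l (hp H N φ) + φ (l.map (H 0)) + φ (l.map (H N)) := by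
  have : dl l (hp H N φ) = ∑ j ∈ Finset.range N, dl l (fun m => pr (H j) (H (j + 1)) m φ) :=
    dl_sum l _ _
  rw [this]
  simp only [hp, prism]
  induction N with
  | zero => simp [z2]
  | succ n ih =>
    have ih := ih (dl_sum l _ _)
    rw [Finset.sum_range_succ, ih, Finset.sum_range_succ]
    linear_combination z2 (φ (l.map (H n)))

/-- `1 + T` -/
def op (T : V → V) (φ : Co V) : Co V := fun l => φ l + φ (l.map T)

theorem op_add (T : V → V) (φ ψ : Co V) :
    op T (fun m => φ m + ψ m) = fun m => op T φ m + op T ψ m := by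
  funext l; simp only [op]; ring

theorem op_dl (T : V → V) (φ : Co V) : op T (fun m => dl m φ) = fun m => dl m (op T φ) := by
  funext l; simp only [op]; rw [dl_map, ← dl_add]; rfl

theorem op_op (T : V → V) (hT : ∀ v, T (T v) = v) (φ : Co V) : op T (op T φ) = fun _ => 0 := by
  funext l
  have : (l.map T).map T = l := by
    rw [List.map_map]; convert List.map_id l; funext v; simp [hT]
  simp only [op, this]
  linear_combination z2 (φ l) + z2 (φ (l.map T))

theorem op_comm (T S : V → V) (hT : ∀ v, T (S v) = S (T v)) (φ : Co V) :
    op T (op S φ) = op S (op T φ) := by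
  funext l
  simp only [op, List.map_map]
  have : T ∘ S = S ∘ T := funext hT
  rw [this]; ring

/-- The data of the homotopies -/
structure Dat (V : Type*) where
  T1 : V → V
  T2 : V → V
  H1 : ℕ → ℕ → V → V
  H2 : ℕ → ℕ → V → V
  N : ℕ
  pt : V
  t1 : ∀ v, T1 (T1 v) = v
  t2 : ∀ v, T2 (T2 v) = v
  t12 : ∀ v, T1 (T2 v) = T2 (T1 v)
  h10 : ∀ p v, H1 p 0 v = v
  h20 : ∀ p v, H2 p 0 v = v
  h1N : ∀ p v, H1 p N (T1 v) = H1 p N v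
  h2N : ∀ p v, H2 p N (T2 v) = H2 p N v
  hc : ∀ p j v, H1 p j (T2 v) = T2 (H1 p j v)

variable (D : Dat V)

def ch : ℕ → ℕ → Co V → ZMod 2
  | 0, 0, φ => φ [D.pt]
  | 0, q + 1, φ => ch 0 q (op D.T2 (hp (D.H2 (q + 1)) D.N φ))
  | p + 1, q, φ => ch p q (op D.T1 (hp (D.H1 (p + 1)) D.N φ))

theorem ch0s (q : ℕ) (φ : Co V) :
    ch D 0 (q+1) φ = ch D 0 q (op D.T2 (hp (D.H2 (q + 1)) D.N φ)) := by
  rw [ch]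

theorem chs (p q : ℕ) (φ : Co V) :
    ch D (p+1) q φ = ch D p q (op D.T1 (hp (D.H1 (p + 1)) D.N φ)) := by
  rw [ch]

theorem ch_add (p q : ℕ) : ∀ φ ψ : Co V,
    ch D p q (fun m => φ m + ψ m) = ch D p q φ + ch D p q ψ := by
  induction p with
  | zero =>
    induction q with
    | zero => intro φ ψ; simp [ch]
    | succ q ih =>
      intro φ ψ
      rw [ch0s, ch0s, ch0s, ← ih, ← op_add]
      congr 2; funext l; exact hp_add _ _ _ _ _
  | succ p ih =>
    intro φ ψ
    rw [chs, chs, chs, ← ih, ← op_add]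
    congr 2; funext l; exact hp_add _ _ _ _ _

theorem ch_zero (p q : ℕ) : ch D p q (fun _ => 0) = 0 := by
  have := ch_add D p q (fun _ => 0) (fun _ => 0)
  simpa using this

theorem key (T : V → V) (H : ℕ → V → V) (N : ℕ) (h0 : ∀ v, H 0 v = v)
    (hN : ∀ v, H N (T v) = H N v) (φ : Co V) :
    op T (hp H N (fun m => dl m φ)) = fun m => dl m (op T (hp H N φ)) + op T φ m := by
  have e : hp H N (fun m => dl m φ) = fun l => dl l (hp H N φ) + (φ l + φ (l.map (H N))) := by
    funext l
    rw [hp_dl]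
    have : l.map (H 0) = l := by convert List.map_id l; funext v; simp [h0]
    rw [this]; ring
  rw [e, op_add, op_dl, op_add]
  funext l
  have : op T (fun l => φ (l.map (H N))) l = 0 := by
    simp only [op, List.map_map]
    have : H N ∘ T = H N := funext hN
    rw [this, z2]
  simp only [this, add_zero]

/-- boundary terms -/
def b1 : ℕ → ℕ → Co V → ZMod 2
  | 0, _, _ => 0
  | p + 1, q, φ => ch D p q (op D.T1 φ)

def b2 : ℕ → ℕ → Co V → ZMod 2
  | _, 0, _ => 0
  | p, q + 1, φ => ch D p q (op D.T2 φ)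

theorem ch_dl (p q : ℕ) : ∀ φ : Co V, φ [] = 0 →
    ch D p q (fun m => dl m φ) = b1 D p q φ + b2 D p q φ := by
  induction p with
  | zero =>
    induction q with
    | zero => intro φ h; simp [ch, b1, b2, dl, h]
    | succ q ih =>
      intro φ h
      rw [ch0s, key _ _ _ (D.h20 _) (D.h2N _), ch_add, ih]
      · have : b2 D 0 q (op D.T2 (hp (D.H2 (q+1)) D.N φ)) = 0 := by
          cases q with
          | zero => rfl
          | succ q => simp only [b2]; rw [op_op _ D.t2, ch_zero]
        rw [this]; simp [b1, b2]
      · simp [op, z2]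
  | succ p ih =>
    intro φ h
    rw [chs, key _ _ _ (D.h10 _) (D.h1N _), ch_add, ih]
    · have : b1 D p q (op D.T1 (hp (D.H1 (p+1)) D.N φ)) = 0 := by
        cases p with
        | zero => rfl
        | succ q => simp only [b1]; rw [op_op _ D.t1, ch_zero]
      rw [this]
      cases q with
      | zero => simp [b1, b2]
      | succ q =>
        simp only [b1, b2]
        rw [chs, op_comm D.T2 D.T1 (fun v => (D.t12 v).symm)]
        have : op D.T2 (hp (D.H1 (p+1)) D.N φ) = hp (D.H1 (p+1)) D.N (op D.T2 φ) := by
          funext l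
          simp only [op]
          rw [hp_map _ _ _ (D.hc _)]
          exact (hp_add _ _ _ _ _).symm
        rw [this]; ring
    · simp [op, z2]

/-- cup product of the sign-change cocycles -/
def cup : List (V → ZMod 2) → Co V
  | [], [_] => 1
  | [], _ => 0
  | s :: ss, v :: w :: l => (s v + s w) * cup ss (w :: l)
  | _ :: _, _ => 0

def pre (s : V → ZMod 2) (ss : List (V → ZMod 2)) : Co V
  | [] => 0
  | v :: l => s v * cup ss (v :: l)

theorem dl_pre (s : V → ZMod 2) (ss : List (V → ZMod 2))
    (h : ∀ l, dl l (cup ss) = 0) (l : List V) : dl l (pre s ss) = cup (s :: ss) l := by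
  match l with
  | [] => simp [dl, cup]
  | [v] => simp [dl, cup, pre]
  | v :: w :: l =>
    rw [dl]
    have e : (fun m => pre s ss (v :: m)) = fun m => s v * cup ss (v :: m) := by
      funext m; simp [pre]
    rw [e, dl_mul]
    have := h (v :: w :: l)
    rw [dl] at this
    simp only [pre, cup]
    linear_combination s v * this - z2 (s v * cup ss (w :: l))

theorem dl_long (l : List V) : ∀ φ : Co V, (∀ m, φ m = 0) → dl l φ = 0 := by
  intro φ h
  have : φ = fun _ => 0 := funext h
  rw [this, dl_zero]

theorem dl_cup (ss : List (V → ZMod 2)) : ∀ l, dl l (cup ss) = 0 := by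
  induction ss with
  | nil =>
    intro l
    match l with
    | [] => rfl
    | [v] => simp [dl, cup]
    | [v, w] => simp [dl, cup, z2]
    | v :: w :: x :: l =>
      simp only [dl, cup]
      rw [dl_long]
      · simp
      · intro m; simp [cup]
  | cons s ss ih =>
    intro l
    have : cup (s :: ss) = fun m => dl m (pre s ss) := by
      funext m; exact (dl_pre s ss ih m).symm
    rw [this, dl_dl]

theorem ch_cup_nil (p q : ℕ) : ch D p q (cup []) = if p = 0 ∧ q = 0 then 1 else 0 := by
  have A : ∀ (H : ℕ → V → V) N l, hp H N (cup []) l = 0 := by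
    intro H N l
    refine Finset.sum_eq_zero fun j _ => pr_vanish _ _ _ _ ?_
    intro l' hl' _
    match l', hl' with
    | v :: w :: l, _ => simp [cup]
  match p, q with
  | 0, 0 => simp [ch, cup]
  | 0, q+1 =>
    rw [ch0s]
    have : op D.T2 (hp (D.H2 (q+1)) D.N (cup [])) = fun _ => 0 := by
      funext l; simp [op, A]
    rw [this, ch_zero]; simp
  | p+1, q =>
    rw [chs]
    have : op D.T1 (hp (D.H1 (p+1)) D.N (cup [])) = fun _ => 0 := by
      funext l; simp [op, A]
    rw [this, ch_zero]; simp

/-- support predicate -/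
structure Supp (L : ℕ → ℕ → List V → Prop) (P Q : ℕ) : Prop where
  base : L 0 0 [D.pt]
  m1 : ∀ p q l, L p q l → L p q (l.map D.T1)
  m2 : ∀ p q l, L p q l → L p q (l.map D.T2)
  s1 : ∀ p q l l' j, p + 1 ≤ P → q ≤ Q → L p q l → j < D.N →
    (∀ x ∈ l', ∃ v ∈ l, x = D.H1 (p+1) j v ∨ x = D.H1 (p+1) (j+1) v) → L (p+1) q l'
  s2 : ∀ p q l l' j, p ≤ P → q + 1 ≤ Q → L p q l → j < D.N →
    (∀ x ∈ l', ∃ v ∈ l, x = D.H2 (q+1) j v ∨ x = D.H2 (q+1) (j+1) v) → L p (q+1) l'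

variable {D}

theorem ch_supp {L : ℕ → ℕ → List V → Prop} {P Q : ℕ} (S : Supp D L P Q) (p q : ℕ)
    (hp' : p ≤ P) (hq : q ≤ Q) : ∀ φ : Co V, (∀ l, L p q l → φ l = 0) → ch D p q φ = 0 := by
  induction p with
  | zero =>
    induction q with
    | zero => intro φ h; simpa [ch] using h _ S.base
    | succ q ih =>
      intro φ h
      rw [ch0s]
      apply ih (by omega)
      have A : ∀ l, L 0 q l → hp (D.H2 (q+1)) D.N φ l = 0 := by
        intro l hl
        refine Finset.sum_eq_zero fun j hj => pr_vanish _ _ _ _ ?_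
        intro l' _ hx
        exact h _ (S.s2 0 q l l' j hp' hq hl (Finset.mem_range.1 hj) hx)
      intro l hl
      simp [op, A l hl, A _ (S.m2 _ _ _ hl)]
  | succ p ih =>
    intro φ h
    rw [chs]
    apply ih (by omega)
    have A : ∀ l, L p q l → hp (D.H1 (p+1)) D.N φ l = 0 := by
      intro l hl
      refine Finset.sum_eq_zero fun j hj => pr_vanish _ _ _ _ ?_
      intro l' _ hx
      exact h _ (S.s1 p q l l' j hp' hq hl (Finset.mem_range.1 hj) hx)
    intro l hl
    simp [op, A l hl, A _ (S.m1 _ _ _ hl)]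

theorem ch_congr {L : ℕ → ℕ → List V → Prop} {P Q : ℕ} (S : Supp D L P Q) (p q : ℕ)
    (hp' : p ≤ P) (hq : q ≤ Q) (φ ψ : Co V) (h : ∀ l, L p q l → φ l = ψ l) :
    ch D p q φ = ch D p q ψ := by
  have := ch_supp S p q hp' hq (fun m => φ m + ψ m) (fun l hl => by rw [h l hl, z2])
  rw [ch_add] at this
  linear_combination this - z2 (ch D p q ψ)

theorem ch_mul (p q : ℕ) (a : ZMod 2) (φ : Co V) :
    ch D p q (fun m => a * φ m) = a * ch D p q φ := by
  have : a = 0 ∨ a = 1 := by revert a; decide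
  rcases this with rfl | rfl
  · simp [ch_zero]
  · simp

/-- coefficient -/
def W : List (ZMod 2 × ZMod 2) → ℕ → ℕ → ZMod 2
  | [], 0, 0 => 1
  | [], _, _ => 0
  | _ :: _, 0, 0 => 0
  | x :: r, p + 1, 0 => x.1 * W r p 0
  | x :: r, 0, q + 1 => x.2 * W r 0 q
  | x :: r, p + 1, q + 1 => x.1 * W r p (q + 1) + x.2 * W r (p + 1) q

theorem cup_map (T : V → V) (ss : List ((V → ZMod 2))) : ∀ (l : List V),
    (∀ s ∈ ss, ∃ a, ∀ v ∈ l, s (T v) = s v + a) → cup ss (l.map T) = cup ss l := by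
  induction ss with
  | nil =>
    intro l _
    match l with
    | [] => rfl
    | [v] => simp [cup]
    | v :: w :: l => simp [cup]
  | cons s ss ih =>
    intro l h
    match l with
    | [] => rfl
    | [v] => simp [cup]
    | v :: w :: l =>
      have := ih (w :: l) (fun s hs => by
        obtain ⟨a, ha⟩ := h s (by simp [hs])
        exact ⟨a, fun v hv => ha v (by simp at hv ⊢; tauto)⟩)
      simp only [List.map_cons, cup] at this ⊢
      rw [this]
      obtain ⟨a, ha⟩ := h s (by simp)
      rw [ha v (by simp), ha w (by simp)]
      linear_combination z2 a * cup ss (w :: l)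

theorem op_pre (T : V → V) (s : V → ZMod 2) (ss : List ((V → ZMod 2))) (l : List V) (a : ZMod 2)
    (hs : ∀ v ∈ l, s (T v) = s v + a)
    (h : ∀ s ∈ ss, ∃ a, ∀ v ∈ l, s (T v) = s v + a) :
    op T (pre s ss) l = a * cup ss l := by
  have hm := cup_map T ss l h
  match l with
  | [] =>
    simp only [op, List.map_nil, z2]
    cases ss <;> simp [cup]
  | v :: l =>
    simp only [List.map_cons] at hm
    simp only [op, List.map_cons, pre]
    rw [hm, hs v (by simp)]
    linear_combination z2 (s v) * cup ss (v :: l)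

theorem main_eval {L : ℕ → ℕ → List V → Prop} {P Q : ℕ} (S : Supp D L P Q)
    (ss : List ((V → ZMod 2) × (ZMod 2 × ZMod 2)))
    (hs : ∀ s ∈ ss, ∀ p q l, L p q l → ∀ v ∈ l,
      s.1 (D.T1 v) = s.1 v + s.2.1 ∧ s.1 (D.T2 v) = s.1 v + s.2.2) :
    ∀ p q, p ≤ P → q ≤ Q →
    ch D p q (cup (ss.map Prod.fst)) = W (ss.map Prod.snd) p q := by
  induction ss with
  | nil =>
    intro p q _ _
    rw [List.map_nil, ch_cup_nil]
    match p, q with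
    | 0, 0 => simp [W]
    | 0, q + 1 => simp [W]
    | p+1, q => simp [W]
  | cons s ss ih =>
    intro p q hp' hq
    have ih := ih (fun s h => hs s (by simp [h]))
    simp only [List.map_cons]
    have e : cup (s.1 :: ss.map Prod.fst) = fun m => dl m (pre s.1 (ss.map Prod.fst)) := by
      funext m; exact (dl_pre _ _ (dl_cup _) m).symm
    rw [e, ch_dl D p q _ rfl]
    have B1 : ∀ p q, p ≤ P → q ≤ Q → ch D p q (op D.T1 (pre s.1 (ss.map Prod.fst))) =
        s.2.1 * W (ss.map Prod.snd) p q := by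
      intro p q h1 h2
      rw [← ih p q h1 h2, ← ch_mul]
      apply ch_congr S p q h1 h2
      intro l hl
      apply op_pre
      · exact fun v hv => (hs s (by simp) p q l hl v hv).1
      · intro s' hs'
        obtain ⟨x, hx, rfl⟩ := List.mem_map.1 hs'
        exact ⟨x.2.1, fun v hv => (hs x (by simp [hx]) p q l hl v hv).1⟩
    have B2 : ∀ p q, p ≤ P → q ≤ Q → ch D p q (op D.T2 (pre s.1 (ss.map Prod.fst))) =
        s.2.2 * W (ss.map Prod.snd) p q := by
      intro p q h1 h2
      rw [← ih p q h1 h2, ← ch_mul]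
      apply ch_congr S p q h1 h2
      intro l hl
      apply op_pre
      · exact fun v hv => (hs s (by simp) p q l hl v hv).2
      · intro s' hs'
        obtain ⟨x, hx, rfl⟩ := List.mem_map.1 hs'
        exact ⟨x.2.2, fun v hv => (hs x (by simp [hx]) p q l hl v hv).2⟩
    match p, q with
    | 0, 0 => simp [b1, b2, W]
    | 0, q + 1 => simp [b1, b2, W, B2 0 q (by omega) (by omega)]
    | p+1, 0 => simp [b1, b2, W, B1 p 0 (by omega) (by omega)]
    | p+1, q+1 => simp [b1, b2, W, B1 p (q+1) (by omega) (by omega), B2 (p+1) q (by omega) (by omega)]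

theorem W_g (n : ℕ) : ∀ p q, W (List.replicate n (0, 1)) p q = if p = 0 ∧ q = n then 1 else 0 := by
  induction n with
  | zero =>
    intro p q
    match p, q with
    | 0, 0 => simp [W]
    | 0, q + 1 => simp [W]
    | p+1, q => simp [W]
  | succ n ih =>
    intro p q
    rw [List.replicate_succ]
    match p, q with
    | 0, 0 => simp [W]
    | 0, q + 1 => simp [W, ih]
    | p+1, 0 => simp [W]
    | p+1, q+1 => simp [W, ih]

theorem W_h (n k : ℕ) : ∀ p q, q ≤ n →
    W (List.replicate k (1, 1) ++ List.replicate n (0, 1)) p q =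
      if p = k ∧ q = n then 1 else 0 := by
  induction k with
  | zero => intro p q _; simpa using W_g n p q
  | succ k ih =>
    intro p q hq
    rw [List.replicate_succ, List.cons_append]
    match p, q with
    | 0, 0 => simp [W]
    | 0, q + 1 =>
      simp only [W]; rw [ih _ _ (by omega), if_neg (by omega), if_neg (by omega)]; simp
    | p+1, 0 => simp [W, ih _ _ hq]
    | p+1, q+1 =>
      simp only [W]; rw [ih _ _ hq, ih _ _ (by omega)]
      rw [if_neg (show ¬ (p + 1 = k ∧ q = n) by omega)]
      simp

/-- a simplex with all sign changes exists -/
theorem exists_simplex {L : ℕ → ℕ → List V → Prop} {d : ℕ} {n : ℕ} (S : Supp D L d n)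
    (hh : List (V → ZMod 2)) (gg : List (V → ZMod 2)) (hhl : hh.length = d) (ggl : gg.length = n)
    (h1 : ∀ s ∈ hh, ∀ p q l, L p q l → ∀ v ∈ l, s (D.T1 v) = s v + 1 ∧ s (D.T2 v) = s v + 1)
    (h2 : ∀ s ∈ gg, ∀ p q l, L p q l → ∀ v ∈ l, s (D.T1 v) = s v ∧ s (D.T2 v) = s v + 1) :
    ∃ l, L d n l ∧ cup (hh ++ gg) l ≠ 0 := by
  by_contra hcon
  push Not at hcon
  have e0 := ch_supp S d n le_rfl le_rfl _ hcon
  have := main_eval S (hh.map (fun s => (s, ((1 : ZMod 2), (1 : ZMod 2)))) ++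
    gg.map (fun s => (s, ((0 : ZMod 2), (1 : ZMod 2))))) (by
      intro s hs
      rcases List.mem_append.1 hs with hs | hs
      · obtain ⟨x, hx, rfl⟩ := List.mem_map.1 hs
        exact h1 x hx
      · obtain ⟨x, hx, rfl⟩ := List.mem_map.1 hs
        simpa using h2 x hx) d n le_rfl le_rfl
  simp only [List.map_append, List.map_map, Function.comp_def, List.map_const', List.map_id'] at this
  rw [e0, hhl, ggl, W_h _ _ _ _ le_rfl] at this
  simp at this

theorem cup_ne (ss : List (V → ZMod 2)) : ∀ l, cup ss l ≠ 0 →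
    l ≠ [] ∧ ∀ s ∈ ss, ∃ v ∈ l, ∃ w ∈ l, s v ≠ s w := by
  induction ss with
  | nil =>
    intro l h
    refine ⟨?_, by simp⟩
    rintro rfl; simp [cup] at h
  | cons s ss ih =>
    intro l h
    match l with
    | [] => simp [cup] at h
    | [v] => simp [cup] at h
    | v :: w :: l =>
      simp only [cup] at h
      refine ⟨by simp, ?_⟩
      intro s' hs'
      rcases List.mem_cons.1 hs' with rfl | hs'
      · refine ⟨v, by simp, w, by simp, ?_⟩
        intro e
        rw [e, z2] at h; simp at h
      · obtain ⟨a, ha, b, hb, hab⟩ := (ih _ (right_ne_zero_of_mul h)).2 s' hs'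
        exact ⟨a, by simp at ha ⊢; tauto, b, by simp at hb ⊢; tauto, hab⟩

end

end EqMap

namespace EqMap

section geom

theorem num (d : ℕ) (hd : 1 ≤ d) (a : ℕ → ℝ) (c : ℝ) (hs : ∑ i ∈ Finset.range (2 * d), a i = 0)
    (h1 : ∀ i < d, |a i - a (2 * d - 1 - i)| ≤ c) (h2 : ∀ i < d - 1, |a i + a (2 * d - 1 - i)| ≤ c) :
    ∀ i < 2 * d, |a i| ≤ d * c := by
  have hc : 0 ≤ c := (abs_nonneg _).trans (h1 0 (by omega))
  have hdc : c ≤ d * c := by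
    have : (1 : ℝ) ≤ d := by exact_mod_cast hd
    nlinarith
  have hsum : ∑ i ∈ Finset.range d, (a i + a (2 * d - 1 - i)) = 0 := by
    rw [Finset.sum_add_distrib, ← hs, two_mul, Finset.sum_range_add, ← Finset.sum_range_reflect (fun x => a (d + x))]
    congr 1
    refine Finset.sum_congr rfl fun i hi => ?_
    rw [Finset.mem_range] at hi
    congr 1; omega
  have h3 : ∀ i < d, |a i + a (2 * d - 1 - i)| ≤ d * c := by
    intro i hi
    by_cases hi' : i < d - 1
    · exact (h2 i hi').trans hdc
    · have : i = d - 1 := by omega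
      subst this
      obtain ⟨n, rfl⟩ : ∃ n, d = n + 1 := ⟨d - 1, by omega⟩
      rw [Finset.sum_range_succ] at hsum
      simp only [Nat.add_sub_cancel] at hsum h2 ⊢
      have e : a n + a (2 * (n + 1) - 1 - n) = - ∑ i ∈ Finset.range n, (a i + a (2 * (n+1) - 1 - i)) := by
        linarith
      rw [e, abs_neg]
      refine (Finset.abs_sum_le_sum_abs _ _).trans ?_
      refine (Finset.sum_le_sum (fun i hi => h2 i (Finset.mem_range.1 hi))).trans ?_
      simp
      nlinarith
  have h4 : ∀ i < d, |a i| ≤ d * c ∧ |a (2 * d - 1 - i)| ≤ d * c := by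
    intro i hi
    have A := abs_le.1 (h1 i hi)
    have B := abs_le.1 (h3 i hi)
    constructor <;> rw [abs_le] <;> constructor <;> linarith [A.1, A.2, B.1, B.2]
  intro i hi
  by_cases h : i < d
  · exact (h4 i h).1
  · have := (h4 (2 * d - 1 - i) (by omega)).2
    rwa [show 2 * d - 1 - (2 * d - 1 - i) = i by omega] at this

theorem exists_sigma (E : Type*) [AddCommGroup E] : ∃ σ : E → ZMod 2, ∀ x, x ≠ -x → σ (-x) = σ x + 1 := by
  classical
  refine ⟨fun x => if WellOrderingRel x (-x) then 1 else 0, fun x hx => ?_⟩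
  simp only [neg_neg]
  rcases trichotomous_of (WellOrderingRel (α := E)) x (-x) with h | h | h
  · rw [if_pos h, if_neg (asymm_of _ h)]; decide
  · exact absurd h hx
  · rw [if_pos h, if_neg (asymm_of _ h)]; decide

noncomputable def sg (r : ℝ) (t : ZMod 2) : ZMod 2 := if 0 < r then 1 else if r < 0 then 0 else t

theorem sg_neg (r : ℝ) (t : ZMod 2) : sg (-r) (t + 1) = sg r t + 1 := by
  unfold sg
  rcases lt_trichotomy r 0 with h | h | h
  · simp [h, h.le, h.not_gt]
  · simp [h]
  · simp [h, h.le, h.not_gt]; decide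

theorem sg_ne {r r' : ℝ} {t t' : ZMod 2} (h : sg r t ≠ sg r' t') : |r| ≤ |r - r'| := by
  have : (0 ≤ r ∧ r' ≤ 0) ∨ (r ≤ 0 ∧ 0 ≤ r') := by
    by_contra hc
    push Not at hc
    apply h
    unfold sg
    rcases lt_trichotomy r 0 with h | h | h
    · have := hc.2 h.le
      simp [h, h.not_gt, this, this.not_gt]
    · have := hc.1 h.ge
      have := hc.2 h.le
      linarith
    · have := hc.1 h.le
      simp [h, this]
  rcases this with ⟨h1, h2⟩ | ⟨h1, h2⟩
  · rw [abs_of_nonneg h1, abs_of_nonneg (by linarith)]; linarith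
  · rw [abs_of_nonpos h1, abs_of_nonpos (by linarith)]; linarith

variable (d : ℕ)

abbrev Eu := EuclideanSpace ℝ (Fin (d + 1))

noncomputable def e (k : ℕ) : Eu d := EuclideanSpace.single (Fin.ofNat (d + 1) k) 1

noncomputable def ro (N k j : ℕ) (x : Eu d) : Eu d :=
  Real.cos (j * (Real.pi / 2 / N)) • x + Real.sin (j * (Real.pi / 2 / N)) • e d k

theorem ro_zero (N k : ℕ) (x : Eu d) : ro d N k 0 x = x := by simp [ro]

theorem ro_last (N k : ℕ) (hN : N ≠ 0) (x : Eu d) : ro d N k N x = e d k := by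
  have : (N : ℝ) ≠ 0 := by exact_mod_cast hN
  have h : (N : ℝ) * (Real.pi / 2 / N) = Real.pi / 2 := by field_simp
  simp [ro, h]

noncomputable def DD (N : ℕ) (hN : N ≠ 0) : Dat (Eu d × Eu d) where
  T1 v := (-v.1, v.2)
  T2 v := (v.1, -v.2)
  H1 p j v := (ro d N p j v.1, v.2)
  H2 p j v := (v.1, ro d N p j v.2)
  N := N
  pt := (e d 0, e d 0)
  t1 v := by simp
  t2 v := by simp
  t12 v := by simp
  h10 p v := by simp [ro_zero]
  h20 p v := by simp [ro_zero]
  h1N p v := by simp [ro_last d N p hN]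
  h2N p v := by simp [ro_last d N p hN]
  hc p j v := by simp

/-- the sphere `S^p` -/
def A (p : ℕ) (x : Eu d) : Prop := ‖x‖ = 1 ∧ ∀ i : Fin (d + 1), p < (i : ℕ) → x i = 0

theorem A_zero : A d 0 (e d 0) := by
  refine ⟨by simp [e], fun i hi => ?_⟩
  have : i ≠ 0 := by rintro rfl; simp at hi
  simp [e, this]

theorem A_neg {p : ℕ} {x : Eu d} (h : A d p x) : A d p (-x) :=
  ⟨by rw [norm_neg]; exact h.1, fun i hi => by simp [h.2 i hi]⟩

theorem A_ro {p : ℕ} {x : Eu d} (hp : p + 1 ≤ d) (h : A d p x) (N j : ℕ) :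
    A d (p + 1) (ro d N (p + 1) j x) := by
  have hv : ((Fin.ofNat (d + 1) (p + 1) : Fin (d+1)) : ℕ) = p + 1 := by
    simp [Fin.ofNat]; omega
  have h0 : x (Fin.ofNat (d + 1) (p + 1)) = 0 := h.2 _ (by omega)
  refine ⟨?_, fun i hi => ?_⟩
  · have : ‖ro d N (p+1) j x‖ ^ 2 = 1 := by
      rw [ro, norm_add_sq_real, norm_smul, norm_smul, inner_smul_left, inner_smul_right]
      have hi : inner ℝ x (e d (p + 1)) = 0 := by
        simp [e, EuclideanSpace.inner_single_right, h0, -Fin.ofNat_eq_cast]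
      rw [hi, h.1]
      have : ‖e d (p+1)‖ = 1 := by simp [e]
      rw [this]
      simp
    nlinarith [norm_nonneg (ro d N (p+1) j x)]
  · have hne : i ≠ Fin.ofNat (d + 1) (p + 1) := by
      intro hh; rw [hh] at hi; omega
    simp [ro, e, h.2 i (by omega), hne, -Fin.ofNat_eq_cast]

theorem ro_dist (N k j j' : ℕ) (hN : N ≠ 0) (x y : Eu d) (hx : ‖x‖ = 1) (hj : j ≤ j' + 1) (hj' : j' ≤ j + 1) :
    dist (ro d N k j x) (ro d N k j' y) ≤ dist x y + Real.pi / N := by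
  set t := Real.pi / 2 / N with ht
  have hN0 : (0 : ℝ) < N := by exact_mod_cast Nat.pos_of_ne_zero hN
  have ht0 : 0 ≤ t := by positivity
  have hjj : |(j : ℝ) * t - j' * t| ≤ t := by
    rw [← sub_mul, abs_mul, abs_of_nonneg ht0]
    have : |(j : ℝ) - j'| ≤ 1 := by
      have h1 : (j : ℝ) ≤ j' + 1 := by exact_mod_cast hj
      have h2 : (j' : ℝ) ≤ j + 1 := by exact_mod_cast hj'
      rw [abs_le]; constructor <;> linarith
    nlinarith
  have e1 : ro d N k j x - ro d N k j' y = (Real.cos (j * t) - Real.cos (j' * t)) • x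
      + Real.cos (j' * t) • (x - y) + (Real.sin (j * t) - Real.sin (j' * t)) • e d k := by
    simp only [ro]; module
  have he : ‖e d k‖ = 1 := by simp [e]
  rw [dist_eq_norm, dist_eq_norm, e1]
  have hc : |Real.cos (j * t) - Real.cos (j' * t)| ≤ t := (Real.abs_cos_sub_cos_le _ _).trans hjj
  have hs : |Real.sin (j * t) - Real.sin (j' * t)| ≤ t := (Real.abs_sin_sub_sin_le _ _).trans hjj
  refine (norm_add₃_le).trans ?_
  rw [norm_smul, norm_smul, norm_smul, hx, he, Real.norm_eq_abs, Real.norm_eq_abs, Real.norm_eq_abs]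
  have := mul_le_mul_of_nonneg_right (Real.abs_cos_le_one (j' * t)) (norm_nonneg (x - y))
  have e2 : Real.pi / N = 2 * t := by rw [ht]; field_simp
  rw [e2]
  linarith

def LL (η : ℝ) (p q : ℕ) (l : List (Eu d × Eu d)) : Prop :=
  (∀ v ∈ l, A d p v.1 ∧ A d q v.2) ∧
    ∀ v ∈ l, ∀ w ∈ l, dist v.1 w.1 ≤ p * η ∧ dist v.2 w.2 ≤ q * η

theorem supp (N : ℕ) (hN : N ≠ 0) : Supp (DD d N hN) (LL d (Real.pi / N)) d d where
  base := by
    refine ⟨?_, ?_⟩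
    · simp [DD, A_zero]
    · simp [DD]
  m1 := by
    rintro p q l ⟨h1, h2⟩
    refine ⟨?_, ?_⟩
    · intro v hv
      obtain ⟨w, hw, rfl⟩ := List.mem_map.1 hv
      exact ⟨A_neg d (h1 w hw).1, (h1 w hw).2⟩
    · intro v hv v' hv'
      obtain ⟨w, hw, rfl⟩ := List.mem_map.1 hv
      obtain ⟨w', hw', rfl⟩ := List.mem_map.1 hv'
      simpa [DD] using h2 w hw w' hw'
  m2 := by
    rintro p q l ⟨h1, h2⟩
    refine ⟨?_, ?_⟩
    · intro v hv
      obtain ⟨w, hw, rfl⟩ := List.mem_map.1 hv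
      exact ⟨(h1 w hw).1, A_neg d (h1 w hw).2⟩
    · intro v hv v' hv'
      obtain ⟨w, hw, rfl⟩ := List.mem_map.1 hv
      obtain ⟨w', hw', rfl⟩ := List.mem_map.1 hv'
      simpa [DD] using h2 w hw w' hw'
  s1 := by
    rintro p q l l' j hp hq ⟨h1, h2⟩ hj hx
    have hx : ∀ x ∈ l', ∃ v ∈ l, ∃ i, (i = j ∨ i = j + 1) ∧ x = (ro d N (p+1) i v.1, v.2) := by
      intro x hxl
      obtain ⟨v, hv, h | h⟩ := hx x hxl
      · exact ⟨v, hv, j, Or.inl rfl, h⟩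
      · exact ⟨v, hv, j + 1, Or.inr rfl, h⟩
    refine ⟨?_, ?_⟩
    · intro x hxl
      obtain ⟨v, hv, i, hi, rfl⟩ := hx x hxl
      exact ⟨A_ro d hp (h1 v hv).1 _ _, (h1 v hv).2⟩
    · intro x hxl x' hxl'
      obtain ⟨v, hv, i, hi, rfl⟩ := hx x hxl
      obtain ⟨v', hv', i', hi', rfl⟩ := hx x' hxl'
      refine ⟨?_, (h2 v hv v' hv').2⟩
      refine (ro_dist d N _ _ _ hN _ _ (h1 v hv).1.1 (by omega) (by omega)).trans ?_
      have := (h2 v hv v' hv').1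
      push_cast; linarith
  s2 := by
    rintro p q l l' j hp hq ⟨h1, h2⟩ hj hx
    have hx : ∀ x ∈ l', ∃ v ∈ l, ∃ i, (i = j ∨ i = j + 1) ∧ x = (v.1, ro d N (q+1) i v.2) := by
      intro x hxl
      obtain ⟨v, hv, h | h⟩ := hx x hxl
      · exact ⟨v, hv, j, Or.inl rfl, h⟩
      · exact ⟨v, hv, j + 1, Or.inr rfl, h⟩
    refine ⟨?_, ?_⟩
    · intro x hxl
      obtain ⟨v, hv, i, hi, rfl⟩ := hx x hxl
      exact ⟨(h1 v hv).1, A_ro d hq (h1 v hv).2 _ _⟩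
    · intro x hxl x' hxl'
      obtain ⟨v, hv, i, hi, rfl⟩ := hx x hxl
      obtain ⟨v', hv', i', hi', rfl⟩ := hx x' hxl'
      refine ⟨(h2 v hv v' hv').1, ?_⟩
      refine (ro_dist d N _ _ _ hN _ _ (h1 v hv).2.1 (by omega) (by omega)).trans ?_
      have := (h2 v hv v' hv').2
      push_cast; linarith

theorem ne_neg {x : Eu d} (h : ‖x‖ = 1) : x ≠ -x := by
  intro hh
  have h2 : (2 : ℝ) • x = 0 := by
    rw [two_smul]; exact add_eq_zero_iff_eq_neg.2 hh
  have : x = 0 := (smul_eq_zero.1 h2).resolve_left two_ne_zero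
  simp [this] at h

theorem core (hd : 1 ≤ d) (F : Eu d × Eu d → ℕ → ℝ)
    (hs : ∀ v, ∑ i ∈ Finset.range (2 * d), F v i = 0)
    (e1 : ∀ v, ‖v.1‖ = 1 → ‖v.2‖ = 1 → ∀ i < 2 * d, F (-v.1, v.2) i = F v (2 * d - 1 - i))
    (e2 : ∀ v, ‖v.1‖ = 1 → ‖v.2‖ = 1 → ∀ i < 2 * d, F (v.1, -v.2) i = - F v i)
    (δ ε : ℝ) (hδ : 0 < δ)
    (hu : ∀ v w : Eu d × Eu d, ‖v.1‖ = 1 → ‖v.2‖ = 1 → ‖w.1‖ = 1 → ‖w.2‖ = 1 → dist v w < δ →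
      ∀ i < 2 * d, |F v i - F w i| ≤ ε) :
    ∃ v : Eu d × Eu d, ‖v.1‖ = 1 ∧ ‖v.2‖ = 1 ∧ ∀ i < 2 * d, |F v i| ≤ d * (4 * ε) := by
  obtain ⟨σ, hσ⟩ := exists_sigma (Eu d)
  obtain ⟨N, hN⟩ := exists_nat_gt (max 1 (d * Real.pi / δ))
  have hN1 : (1 : ℝ) < N := (le_max_left _ _).trans_lt hN
  have hN2 : d * Real.pi / δ < N := (le_max_right _ _).trans_lt hN
  have hN0 : N ≠ 0 := by rintro rfl; norm_num at hN1
  have hsmall : d * (Real.pi / N) < δ := by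
    rw [div_lt_iff₀ hδ] at hN2
    rw [← mul_div_assoc, div_lt_iff₀ (by linarith)]
    linarith
  have S := supp d N hN0
  have S' : Supp (DD d N hN0) (LL d (Real.pi / N)) d (d - 1) :=
    ⟨S.base, S.m1, S.m2, fun p q l l' j h1 h2 => S.s1 p q l l' j h1 (by omega),
      fun p q l l' j h1 h2 => S.s2 p q l l' j h1 (by omega)⟩
  let hf : ℕ → Eu d × Eu d → ℝ := fun i v => F v i - F v (2 * d - 1 - i)
  let gf : ℕ → Eu d × Eu d → ℝ := fun i v => F v i + F v (2 * d - 1 - i)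
  let sh : ℕ → Eu d × Eu d → ZMod 2 := fun i v => sg (hf i v) (σ v.1 + σ v.2)
  let sgg : ℕ → Eu d × Eu d → ZMod 2 := fun i v => sg (gf i v) (σ v.2)
  obtain ⟨l, hl, hc⟩ := exists_simplex S' ((List.range d).map sh) ((List.range (d-1)).map sgg)
    (by simp) (by simp) (by
      intro s hs' p q l hl v hv
      obtain ⟨i, hi, rfl⟩ := List.mem_map.1 hs'
      rw [List.mem_range] at hi
      have a1 := (hl.1 v hv).1.1
      have a2 := (hl.1 v hv).2.1
      constructor
      · have : hf i (-v.1, v.2) = - hf i v := by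
          simp only [hf]
          rw [e1 v a1 a2 i (by omega), e1 v a1 a2 _ (by omega)]
          rw [show 2 * d - 1 - (2 * d - 1 - i) = i by omega]; ring
        simp only [sh, DD, this]
        rw [hσ _ (ne_neg d a1), ← sg_neg]
        congr 1; ring
      · have : hf i (v.1, -v.2) = - hf i v := by
          simp only [hf]
          rw [e2 v a1 a2 i (by omega), e2 v a1 a2 _ (by omega)]
          ring
        simp only [sh, DD, this]
        rw [hσ _ (ne_neg d a2), ← sg_neg]
        congr 1; ring) (by
      intro s hs' p q l hl v hv
      obtain ⟨i, hi, rfl⟩ := List.mem_map.1 hs'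
      rw [List.mem_range] at hi
      have a1 := (hl.1 v hv).1.1
      have a2 := (hl.1 v hv).2.1
      constructor
      · have : gf i (-v.1, v.2) = gf i v := by
          simp only [gf]
          rw [e1 v a1 a2 i (by omega), e1 v a1 a2 _ (by omega)]
          rw [show 2 * d - 1 - (2 * d - 1 - i) = i by omega]; ring
        simp only [sgg, DD, this]
      · have : gf i (v.1, -v.2) = - gf i v := by
          simp only [gf]
          rw [e2 v a1 a2 i (by omega), e2 v a1 a2 _ (by omega)]
          ring
        simp only [sgg, DD, this]
        rw [hσ _ (ne_neg d a2), ← sg_neg])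
  obtain ⟨hne, hch⟩ := cup_ne _ _ hc
  have hd' : ∀ v ∈ l, ∀ w ∈ l, ∀ i < 2 * d, |F v i - F w i| ≤ ε := by
    intro v hv w hw
    refine hu v w (hl.1 v hv).1.1 (hl.1 v hv).2.1 (hl.1 w hw).1.1 (hl.1 w hw).2.1 ?_
    rw [Prod.dist_eq, max_lt_iff]
    have := hl.2 v hv w hw
    refine ⟨this.1.trans_lt hsmall, this.2.trans_lt (lt_of_le_of_lt ?_ hsmall)⟩
    have : ((d - 1 : ℕ) : ℝ) ≤ d := by exact_mod_cast Nat.sub_le d 1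
    have : 0 ≤ Real.pi / N := by positivity
    gcongr
  obtain ⟨v0, hv0⟩ := List.exists_mem_of_ne_nil l hne
  refine ⟨v0, (hl.1 v0 hv0).1.1, (hl.1 v0 hv0).2.1, num d hd (F v0) (4 * ε) (hs v0) ?_ ?_⟩
  · intro i hi
    obtain ⟨v, hv, w, hw, hvw⟩ := hch (sh i) (List.mem_append.2 (Or.inl (List.mem_map.2 ⟨i, by simpa using hi, rfl⟩)))
    have h1 := abs_le.1 (sg_ne hvw)
    have b1 := abs_le.1 (hd' v hv w hw i (by omega))
    have b2 := abs_le.1 (hd' v hv w hw (2 * d - 1 - i) (by omega))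
    have b3 := abs_le.1 (hd' v hv v0 hv0 i (by omega))
    have b4 := abs_le.1 (hd' v hv v0 hv0 (2 * d - 1 - i) (by omega))
    have h2 : |hf i v - hf i w| ≤ 2 * ε := by
      simp only [hf]; rw [abs_le]; constructor <;> linarith [b1.1, b1.2, b2.1, b2.2]
    simp only [hf] at h1 h2
    rw [abs_le]; constructor <;> linarith [b3.1, b3.2, b4.1, b4.2, h1.1, h1.2]
  · intro i hi
    obtain ⟨v, hv, w, hw, hvw⟩ := hch (sgg i) (List.mem_append.2 (Or.inr (List.mem_map.2 ⟨i, by simpa using hi, rfl⟩)))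
    have h1 := abs_le.1 (sg_ne hvw)
    have b1 := abs_le.1 (hd' v hv w hw i (by omega))
    have b2 := abs_le.1 (hd' v hv w hw (2 * d - 1 - i) (by omega))
    have b3 := abs_le.1 (hd' v hv v0 hv0 i (by omega))
    have b4 := abs_le.1 (hd' v hv v0 hv0 (2 * d - 1 - i) (by omega))
    have h2 : |gf i v - gf i w| ≤ 2 * ε := by
      simp only [gf]; rw [abs_le]; constructor <;> linarith [b1.1, b1.2, b2.1, b2.2]
    simp only [gf] at h1 h2
    rw [abs_le]; constructor <;> linarith [b3.1, b3.2, b4.1, b4.2, h1.1, h1.2]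

end geom

end EqMap


/-- There is no continuous `(ℤ/2 ⊕ ℤ/2)`-equivariant map from `S^d × S^d`
to `V ∖ {0}`, where `V` is the space of real functions on `{0,…,2d-1}` summing to
zero, the first generator acting antipodally on the first sphere and by reversal
of coordinates on `V`, the second generator acting antipodally on the second
sphere and by `-1` on `V`. -/
theorem no_equivariant_map_odd (d : ℕ) (hd : 1 ≤ d) :
    ¬ ∃ f : (Metric.sphere (0 : EuclideanSpace ℝ (Fin (d + 1))) 1 ×
              Metric.sphere (0 : EuclideanSpace ℝ (Fin (d + 1))) 1) → (Fin (2 * d) → ℝ),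
        Continuous f ∧
        (∀ p, ∑ i, f p i = 0) ∧
        (∀ p, f p ≠ 0) ∧
        (∀ u v, ∀ i : Fin (2 * d),
          f (-u, v) i = f (u, v) ⟨2 * d - 1 - (i : ℕ), by omega⟩) ∧
        (∀ u v, f (u, -v) = -f (u, v)) := by
  classical
  rintro ⟨f, hf, hs, hne, h1, h2⟩
  have hcu : UniformContinuous f := CompactSpace.uniformContinuous_of_continuous hf
  have hm : ∃ m : ℝ, 0 < m ∧ ∀ p, m ≤ ‖f p‖ := by
    have hx : EqMap.e d 0 ∈ Metric.sphere (0 : EuclideanSpace ℝ (Fin (d + 1))) 1 := by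
      simp [EqMap.e]
    obtain ⟨p, -, hp⟩ := isCompact_univ.exists_isMinOn (s := Set.univ)
      ⟨(⟨_, hx⟩, ⟨_, hx⟩), trivial⟩ (f := fun p => ‖f p‖) hf.norm.continuousOn
    exact ⟨‖f p‖, norm_pos_iff.2 (hne p), fun q => hp (Set.mem_univ q)⟩
  obtain ⟨m, hm0, hm⟩ := hm
  have hd0 : (0 : ℝ) < d := by exact_mod_cast hd
  set ε : ℝ := m / (8 * d) with hε
  have hε0 : 0 < ε := by positivity
  obtain ⟨δ, hδ, hu⟩ := Metric.uniformContinuous_iff.1 hcu ε hε0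
  let F : EqMap.Eu d × EqMap.Eu d → ℕ → ℝ := fun v i =>
    if h : ‖v.1‖ = 1 ∧ ‖v.2‖ = 1 then
      if hi : i < 2 * d then
        f (⟨v.1, by simpa using h.1⟩, ⟨v.2, by simpa using h.2⟩) ⟨i, hi⟩ else 0
    else 0
  have hF : ∀ v (a1 : ‖v.1‖ = 1) (a2 : ‖v.2‖ = 1) i (hi : i < 2 * d), F v i =
      f (⟨v.1, by simpa using a1⟩, ⟨v.2, by simpa using a2⟩) ⟨i, hi⟩ := by
    intro v a1 a2 i hi
    simp only [F]
    rw [dif_pos ⟨a1, a2⟩, dif_pos hi]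
  obtain ⟨v, a1, a2, hv⟩ := EqMap.core d hd F (by
      intro v
      by_cases h : ‖v.1‖ = 1 ∧ ‖v.2‖ = 1
      · rw [← Fin.sum_univ_eq_sum_range (fun i => F v i)]
        rw [← hs (⟨v.1, by simpa using h.1⟩, ⟨v.2, by simpa using h.2⟩)]
        exact Finset.sum_congr rfl fun i _ => hF v h.1 h.2 i i.2
      · refine Finset.sum_eq_zero fun i _ => ?_
        simp only [F]; rw [dif_neg h]) (by
      intro v a1 a2 i hi
      rw [hF (-v.1, v.2) (by simpa using a1) a2 i hi, hF v a1 a2 _ (by omega)]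
      exact h1 ⟨v.1, by simpa using a1⟩ ⟨v.2, by simpa using a2⟩ ⟨i, hi⟩) (by
      intro v a1 a2 i hi
      rw [hF (v.1, -v.2) a1 (by simpa using a2) i hi, hF v a1 a2 i hi]
      exact congrFun (h2 ⟨v.1, by simpa using a1⟩ ⟨v.2, by simpa using a2⟩) ⟨i, hi⟩) δ ε hδ (by
      intro v w a1 a2 b1 b2 hvw i hi
      rw [hF v a1 a2 i hi, hF w b1 b2 i hi, ← Real.dist_eq]
      refine (dist_le_pi_dist _ _ _).trans (hu ?_).le
      exact hvw)
  have := hm (⟨v.1, by simpa using a1⟩, ⟨v.2, by simpa using a2⟩)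
  have hle : ‖f (⟨v.1, by simpa using a1⟩, ⟨v.2, by simpa using a2⟩)‖ ≤ d * (4 * ε) := by
    rw [pi_norm_le_iff_of_nonneg (by positivity)]
    intro i
    rw [Real.norm_eq_abs, ← hF v a1 a2 i i.2]
    exact hv i i.2
  have e : d * (4 * ε) = m / 2 := by rw [hε]; field_simp; norm_num
  linarith
end

section
/- Let d ≥ 1 be an integer. In the polynomial ring (ℤ/2)[x,y], the polynomial y^{d-1}(x+y)^{d-1} does not belong to the ideal generated by x^d and y^d. -/
open MvPolynomial

/-- In `(ℤ/2)[x,y]`, the polynomial `y^(d-1)·(x+y)^(d-1)` does not belong to the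
ideal generated by `x^d` and `y^d`. -/
theorem dickson_two_var_not_in_ideal (d : ℕ) (hd : 1 ≤ d) :
    (X 1 : MvPolynomial (Fin 2) (ZMod 2)) ^ (d - 1) * (X 0 + X 1) ^ (d - 1) ∉
      Ideal.span {(X 0 : MvPolynomial (Fin 2) (ZMod 2)) ^ d, X 1 ^ d} := by
  obtain ⟨n, rfl⟩ : ∃ n, d = n + 1 := ⟨d - 1, by omega⟩
  rw [Nat.add_sub_cancel]
  intro h
  obtain ⟨q, hq⟩ := sub_dvd_pow_sub_pow
    ((X 0 : MvPolynomial (Fin 2) (ZMod 2)) + X 1) (X 0) n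
  have hy : (X 1 : MvPolynomial (Fin 2) (ZMod 2)) ^ (n + 1) * q ∈
      Ideal.span {(X 0 : MvPolynomial (Fin 2) (ZMod 2)) ^ (n + 1), X 1 ^ (n + 1)} :=
    Ideal.mul_mem_right _ _ (Ideal.subset_span (by simp))
  have h2 := Ideal.sub_mem _ h hy
  have e : (X 1 : MvPolynomial (Fin 2) (ZMod 2)) ^ n * (X 0 + X 1) ^ n - X 1 ^ (n + 1) * q
      = monomial (Finsupp.single 1 n + Finsupp.single 0 n) 1 := by
    have : (monomial (Finsupp.single 1 n + Finsupp.single 0 n) 1 :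
        MvPolynomial (Fin 2) (ZMod 2)) = X 1 ^ n * X 0 ^ n := by
      simp [X_pow_eq_monomial, monomial_mul]
    rw [this]
    linear_combination (X 1 ^ n) * hq
  rw [e] at h2
  have hs : ({(X 0 : MvPolynomial (Fin 2) (ZMod 2)) ^ (n + 1), X 1 ^ (n + 1)} : Set _) =
      (fun s => monomial s (1 : ZMod 2)) ''
        {Finsupp.single 0 (n + 1), Finsupp.single 1 (n + 1)} := by
    simp [Set.image_pair, X_pow_eq_monomial]
  rw [hs, mem_ideal_span_monomial_image] at h2
  obtain ⟨s, hs, hle⟩ := h2 (Finsupp.single 1 n + Finsupp.single 0 n) (by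
    rw [mem_support_iff, coeff_monomial]; simp)
  rcases hs with rfl | rfl
  · have := hle 0
    simp at this
  · have := hle 1
    simp at this
end

section
/- Let d ≥ 1 be an integer. In the polynomial ring (ℤ/2)[x,y], the polynomial y^{d-1}(x+y)^d belongs to the ideal generated by x^d and y^d, but does not belong to the ideal generated by x^{d+1} and y^{d+1}. -/
open MvPolynomial

/-- A multiple of `X i ^ n` has zero coefficient at exponents with `m i < n`. -/
theorem aux_coeff_zero (a : MvPolynomial (Fin 2) (ZMod 2)) (i : Fin 2) (n : ℕ)
    (m : Fin 2 →₀ ℕ) (h : m i < n) : coeff m (a * X i ^ n) = 0 := by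
  rw [X_pow_eq_monomial, coeff_mul_monomial', if_neg]
  intro hle
  have := hle i
  simp at this
  omega

/-- In `(ℤ/2)[x,y]`, the polynomial `y^(d-1)·(x+y)^d` belongs to the ideal
generated by `x^d` and `y^d`, but not to the ideal generated by `x^(d+1)`
and `y^(d+1)`. -/
theorem dickson_two_var_odd_case (d : ℕ) (hd : 1 ≤ d) :
    (X 1 : MvPolynomial (Fin 2) (ZMod 2)) ^ (d - 1) * (X 0 + X 1) ^ d ∈
      Ideal.span {(X 0 : MvPolynomial (Fin 2) (ZMod 2)) ^ d, X 1 ^ d} ∧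
    (X 1 : MvPolynomial (Fin 2) (ZMod 2)) ^ (d - 1) * (X 0 + X 1) ^ d ∉
      Ideal.span {(X 0 : MvPolynomial (Fin 2) (ZMod 2)) ^ (d + 1), X 1 ^ (d + 1)} := by
  obtain ⟨e, rfl⟩ : ∃ e, d = e + 1 := ⟨d - 1, by omega⟩
  obtain ⟨q, hq⟩ := sub_dvd_pow_sub_pow (X 0 + X 1 : MvPolynomial (Fin 2) (ZMod 2)) (X 0) (e + 1)
  have key : (X 1 : MvPolynomial (Fin 2) (ZMod 2)) ^ (e + 1 - 1) * (X 0 + X 1) ^ (e + 1)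
      = X 1 ^ e * X 0 ^ (e + 1) + q * X 1 ^ (e + 1) := by
    rw [sub_eq_iff_eq_add] at hq
    rw [hq, Nat.add_sub_cancel]
    ring
  rw [key]
  refine ⟨Ideal.mem_span_pair.2 ⟨_, _, rfl⟩, fun h => ?_⟩
  obtain ⟨a, b, hab⟩ := Ideal.mem_span_pair.1 h
  have hc := congrArg (coeff (Finsupp.single 1 e + Finsupp.single 0 (e + 1))) hab
  rw [coeff_add, coeff_add, aux_coeff_zero _ _ _ _ (by simp), aux_coeff_zero _ _ _ _ (by simp; try omega),
    aux_coeff_zero q _ _ _ (by simp), X_pow_eq_monomial, X_pow_eq_monomial, monomial_mul,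
    coeff_monomial, if_pos rfl] at hc
  simp at hc
end
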